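/- Let F be a convex cone subequation on ℝⁿ satisfying condition (F3), let Ω ⊂ ℝⁿ be a bounded domain with smooth strictly F-convex boundary, and let x₀ ∈ Ω. Assume (H1): h ∈ C(Ω̄) is F-harmonic on Ω ∖ {x₀} with a downward-pointing singularity of finite type at x₀, normalized so that h(x₀) = 0, h > 0 on Ω̄ ∖ {x₀}, and sup_{∂Ω} h = 1; assume also (H3) and (H4) for the h-density Θ_{x₀}. Then there exists a unique nonlinear Green's function G ∈ C(Ω̄): G is F-harmonic on Ω ∖ {x₀}, G = 0 on ∂Ω, and Θ_{x₀}(G) = lim_{x→x₀} (G(x) − G(x₀))/h(x) = 1. Moreover G(x₀) < 0 and x₀ is a strict global minimum point for G on Ω̄. -/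

import Mathlib

open scoped Topology Classical
open Filter

noncomputable section

/-- Euclidean space ℝⁿ. -/
abbrev EucSp (n : ℕ) := EuclideanSpace ℝ (Fin n)

/-- The space Sym²(ℝⁿ) of symmetric real n×n matrices, with its subspace topology. -/
abbrev SymMat (n : ℕ) := selfAdjoint (Matrix (Fin n) (Fin n) ℝ)

variable {n : ℕ}

/-- The matrix of the orthogonal projection onto the line ℝ·e (for a unit vector e). -/
def projMat (e : EucSp n) : Matrix (Fin n) (Fin n) ℝ := Matrix.of fun i j => e i * e j

lemma projMat_selfAdjoint (e : EucSp n) :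
    projMat e ∈ selfAdjoint (Matrix (Fin n) (Fin n) ℝ) := by
  rw [selfAdjoint.mem_iff]
  ext i j
  simp [projMat, Matrix.star_apply, mul_comm]

/-- P_e, the projection onto ℝ·e, as an element of Sym²(ℝⁿ). -/
def symProj (e : EucSp n) : SymMat n := ⟨projMat e, projMat_selfAdjoint e⟩

/-- The matrix P_{e⊥} − (p−1)·P_e. -/
def charMatM (p : ℝ) (e : EucSp n) : Matrix (Fin n) (Fin n) ℝ :=
  (1 - projMat e) - (p - 1) • projMat e

lemma charMatM_selfAdjoint (p : ℝ) (e : EucSp n) :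
    charMatM p e ∈ selfAdjoint (Matrix (Fin n) (Fin n) ℝ) := by
  have h := projMat_selfAdjoint e
  rw [selfAdjoint.mem_iff] at h ⊢
  simp [charMatM, star_sub, star_smul, star_one, h]

/-- P_{e⊥} − (p−1)·P_e as an element of Sym²(ℝⁿ). -/
def charMat (p : ℝ) (e : EucSp n) : SymMat n := ⟨charMatM p e, charMatM_selfAdjoint p e⟩

/-- A (constant coefficient, pure second order) cone subequation on ℝⁿ: a nonempty,
closed, proper subset of Sym²(ℝⁿ) satisfying positivity (F1) and the cone property (F2). -/
structure ConeSubequation (n : ℕ) where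
  carrier : Set (SymMat n)
  nonempty' : carrier.Nonempty
  proper' : carrier ≠ Set.univ
  isClosed' : IsClosed carrier
  f1 : ∀ A ∈ carrier, ∀ P : SymMat n, (P : Matrix (Fin n) (Fin n) ℝ).PosSemidef → A + P ∈ carrier
  f2 : ∀ A ∈ carrier, ∀ t : ℝ, 0 < t → t • A ∈ carrier

/-- The dual of a set of symmetric matrices: F̃ = {A : −A ∉ Int F}. -/
def dualSet (S : Set (SymMat n)) : Set (SymMat n) := {A | -A ∉ interior S}

/-- The subequation P = {A ≥ 0} of positive semidefinite matrices. -/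
def PosP (n : ℕ) : Set (SymMat n) := {A | (A : Matrix (Fin n) (Fin n) ℝ).PosSemidef}

/-- The Hessian matrix (D²f)(x) of a real function on ℝⁿ. -/
def hessMatrix (f : EucSp n → ℝ) (x : EucSp n) : Matrix (Fin n) (Fin n) ℝ :=
  Matrix.of fun i j =>
    iteratedFDeriv ℝ 2 f x ![EuclideanSpace.single i 1, EuclideanSpace.single j 1]

/-- ψ is a test function for u at x₀ (relative to the set X): ψ is C² near x₀,
u ≤ ψ near x₀ (within X), and u(x₀) = ψ(x₀). -/
def IsTestAt (X : Set (EucSp n)) (u : EucSp n → EReal) (ψ : EucSp n → ℝ) (x₀ : EucSp n) :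
    Prop :=
  ContDiffAt ℝ 2 ψ x₀ ∧ (∀ᶠ x in 𝓝[X] x₀, u x ≤ (ψ x : EReal)) ∧ u x₀ = (ψ x₀ : EReal)

/-- u admits no test functions at x₀ (relative to X). -/
def NoTestAt (X : Set (EucSp n)) (u : EucSp n → EReal) (x₀ : EucSp n) : Prop :=
  ∀ ψ : EucSp n → ℝ, ¬ IsTestAt X u ψ x₀

/-- u is S-subharmonic on X (viscosity sense): u is upper semicontinuous on X with values
in [−∞,∞), and for every test function ψ for u at a point of X, the Hessian of ψ there
lies in S. -/
def FSubharmonicOn (S : Set (SymMat n)) (X : Set (EucSp n)) (u : EucSp n → EReal) : Prop :=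
  UpperSemicontinuousOn u X ∧ (∀ x ∈ X, u x ≠ ⊤) ∧
    ∀ x₀ ∈ X, ∀ ψ : EucSp n → ℝ, IsTestAt X u ψ x₀ →
      hessMatrix ψ x₀ ∈ Subtype.val '' S

/-- u is F-harmonic on X: u is F-subharmonic and −u is F̃-subharmonic on X. -/
def FHarmonicOn (F : ConeSubequation n) (X : Set (EucSp n)) (u : EucSp n → EReal) : Prop :=
  FSubharmonicOn F.carrier X u ∧ FSubharmonicOn (dualSet F.carrier) X (fun x => -u x)

/-- u is subaffine on X, i.e. P̃-subharmonic on X. -/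
def SubaffineOn (X : Set (EucSp n)) (u : EucSp n → EReal) : Prop :=
  FSubharmonicOn (dualSet (PosP n)) X u

/-- h is a downward-pointing singular F-harmonic at x₀ on the neighborhood U:
continuous, F-subharmonic on U, F-harmonic on U∖{x₀}, with a strict minimum at x₀, and
either of polar type (h(x₀) = −∞) or of finite type (h(x₀) > −∞, no test functions at x₀). -/
structure DPSingular (F : ConeSubequation n) (U : Set (EucSp n)) (x₀ : EucSp n)
    (h : EucSp n → EReal) : Prop where
  isOpen' : IsOpen U
  mem : x₀ ∈ U
  cont : ContinuousOn h U
  subh : FSubharmonicOn F.carrier U h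
  harm : FHarmonicOn F (U \ {x₀}) h
  strictMin : ∀ x ∈ U, x ≠ x₀ → h x₀ < h x
  polarOrFinite : h x₀ = ⊥ ∨ (h x₀ ≠ ⊥ ∧ NoTestAt U h x₀)

/-- Polar-case asymptotic equivalence H ≈ h at x₀: h − C ≤ H ≤ h + C near x₀. -/
def PolarAsymp (H : EucSp n → ℝ) (h : EucSp n → EReal) (x₀ : EucSp n) : Prop :=
  ∃ C : ℝ, ∀ᶠ x in 𝓝[≠] x₀, h x - (C : EReal) ≤ (H x : EReal) ∧ (H x : EReal) ≤ h x + (C : EReal)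

/-- Finite-case asymptotic equivalence H ∼ h at x₀:
lim_{x→x₀} (H(x) − H(x₀))/(h(x) − h(x₀)) = 1. -/
def FiniteAsymp (H : EucSp n → ℝ) (h : EucSp n → EReal) (x₀ : EucSp n) : Prop :=
  Tendsto (fun x => (H x - H x₀) / ((h x).toReal - (h x₀).toReal)) (𝓝[≠] x₀) (𝓝 1)

/-- Ω is a bounded domain: open, connected and bounded. -/
def IsBoundedDomain (Ω : Set (EucSp n)) : Prop :=
  IsOpen Ω ∧ IsConnected Ω ∧ Bornology.IsBounded Ω

/-- Condition (F3): −P_e ∉ F for every unit vector e. -/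
def CondF3 (F : ConeSubequation n) : Prop :=
  ∀ e : EucSp n, ‖e‖ = 1 → -(symProj e) ∉ F.carrier

/-- The inward unit normal −∇ρ(x)/|∇ρ(x)| of the hypersurface {ρ = 0} bounding {ρ < 0}. -/
def innerNormal (ρ : EucSp n → ℝ) (x : EucSp n) : EucSp n :=
  -(‖gradient ρ x‖⁻¹ • gradient ρ x)

/-- The second fundamental form of {ρ = 0} at x with respect to the inward normal,
extended by zero on the normal line: the tangential part of Hess ρ(x)/|∇ρ(x)|. -/
def secondFF (ρ : EucSp n → ℝ) (x : EucSp n) : Matrix (Fin n) (Fin n) ℝ :=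
  ‖gradient ρ x‖⁻¹ •
    ((1 - projMat (innerNormal ρ x)) * hessMatrix ρ x * (1 - projMat (innerNormal ρ x)))

/-- Ω has smooth boundary which is strictly F-convex: Ω is globally defined by a smooth
defining function ρ with nonvanishing gradient along ∂Ω, and at every boundary point
II_x + t·P_{ν(x)} ∈ Int F for all sufficiently large t. -/
def StrictlyConvexBoundary (F : ConeSubequation n) (Ω : Set (EucSp n)) : Prop :=
  ∃ ρ : EucSp n → ℝ, ContDiff ℝ (⊤ : ℕ∞) ρ ∧ Ω = {x | ρ x < 0} ∧
    ∀ x ∈ frontier Ω, gradient ρ x ≠ 0 ∧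
      ∃ t₀ : ℝ, ∀ t ≥ t₀,
        secondFF ρ x + t • projMat (innerNormal ρ x) ∈ Subtype.val '' interior F.carrier

/-- F is invariant under O(n): gᵀ A g ∈ F for every orthogonal g and A ∈ F. -/
def OrthInvariant (F : ConeSubequation n) : Prop :=
  ∀ g : Matrix (Fin n) (Fin n) ℝ, g.transpose * g = 1 →
    ∀ A ∈ F.carrier, ∀ B : SymMat n,
      (B : Matrix (Fin n) (Fin n) ℝ) = g.transpose * (A : Matrix (Fin n) (Fin n) ℝ) * g →
      B ∈ F.carrier

/-- F has Riesz characteristic p: P_{e⊥} − (p−1)P_e ∈ ∂F for every unit vector e. -/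
def HasRieszChar (F : ConeSubequation n) (p : ℝ) : Prop :=
  ∀ e : EucSp n, ‖e‖ = 1 → charMat p e ∈ frontier F.carrier

/-- The Riesz kernel K_p. -/
def rieszKernel (p : ℝ) (x : EucSp n) : ℝ :=
  if p = 2 then Real.log ‖x‖ else -(p - 2)⁻¹ * ‖x‖ ^ (2 - p)

/-- The symmetrized Hessian, as an element of `SymMat n`. -/
def hessS (f : EucSp n → ℝ) (x : EucSp n) : SymMat n :=
  ⟨(1 / 2 : ℝ) • (hessMatrix f x + (hessMatrix f x).transpose), by
    rw [selfAdjoint.mem_iff]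
    ext i j
    simp [Matrix.star_apply]
    ring⟩

lemma hessMatrix_apply (f : EucSp n → ℝ) (x : EucSp n) (i j : Fin n) :
    hessMatrix f x i j = fderiv ℝ (fderiv ℝ f) x (EuclideanSpace.single i 1)
      (EuclideanSpace.single j 1) := by
  simp [hessMatrix, iteratedFDeriv_two_apply]

lemma hessMatrix_transpose {f : EucSp n → ℝ} {x : EucSp n} (hf : ContDiffAt ℝ 2 f x) :
    (hessMatrix f x).transpose = hessMatrix f x := by
  ext i j
  rw [Matrix.transpose_apply, hessMatrix_apply, hessMatrix_apply]
  exact (hf.isSymmSndFDerivAt (by simp)) _ _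

lemma hessS_coe {f : EucSp n → ℝ} {x : EucSp n} (hf : ContDiffAt ℝ 2 f x) :
    (hessS f x : Matrix (Fin n) (Fin n) ℝ) = hessMatrix f x := by
  simp only [hessS, hessMatrix_transpose hf]
  ext i j
  simp
  ring

lemma hessMatrix_mem_iff {f : EucSp n → ℝ} {x : EucSp n} (hf : ContDiffAt ℝ 2 f x)
    (S : Set (SymMat n)) : hessMatrix f x ∈ Subtype.val '' S ↔ hessS f x ∈ S := by
  rw [← hessS_coe hf]
  simp

lemma symMat_ext {A B : SymMat n}
    (h : ∀ i j, (A : Matrix (Fin n) (Fin n) ℝ) i j = (B : Matrix (Fin n) (Fin n) ℝ) i j) :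
    A = B := Subtype.ext (Matrix.ext h)

lemma hessS_add {f g : EucSp n → ℝ} {x : EucSp n} (hf : ContDiffAt ℝ 2 f x)
    (hg : ContDiffAt ℝ 2 g x) :
    hessS (fun y => f y + g y) x = hessS f x + hessS g x := by
  have : hessMatrix (fun y => f y + g y) x = hessMatrix f x + hessMatrix g x := by
    ext i j
    have := iteratedFDeriv_add_apply (i := 2) (x := x) (f := f) (g := g) hf hg
    simp only [hessMatrix, Matrix.of_apply, Matrix.add_apply]
    change iteratedFDeriv ℝ 2 (f + g) x _ = _
    rw [this]; rfl
  apply Subtype.ext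
  rw [AddSubgroup.coe_add, hessS_coe hf, hessS_coe hg, ← this, hessS_coe (hf.add hg)]

lemma hessS_smul (c : ℝ) {f : EucSp n → ℝ} {x : EucSp n} (hf : ContDiffAt ℝ 2 f x) :
    hessS (fun y => c * f y) x = c • hessS f x := by
  have : hessMatrix (fun y => c * f y) x = c • hessMatrix f x := by
    ext i j
    have := iteratedFDeriv_const_smul_apply (i := 2) (x := x) (f := f) (a := c) (𝕜 := ℝ) hf
    simp only [hessMatrix, Matrix.of_apply, Matrix.smul_apply]
    change iteratedFDeriv ℝ 2 (c • f) x _ = _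
    rw [this]; rfl
  apply Subtype.ext
  rw [selfAdjoint.val_smul, hessS_coe hf, ← this,
    hessS_coe (f := fun y => c * f y) (contDiffAt_const.mul hf)]

lemma hessS_const (c : ℝ) (x : EucSp n) : hessS (fun _ => c) x = 0 := by
  apply symMat_ext
  intro i j
  simp [hessS, hessMatrix_apply]

lemma hessS_neg {f : EucSp n → ℝ} {x : EucSp n} (hf : ContDiffAt ℝ 2 f x) :
    hessS (fun y => - f y) x = - hessS f x := by
  have := hessS_smul (-1) hf
  simpa using this

lemma hessS_continuousAt {f : EucSp n → ℝ} {x : EucSp n} (hf : ContDiffAt ℝ 2 f x) :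
    ContinuousAt (hessS f) x := by
  have h1 : ContinuousAt (iteratedFDeriv ℝ 2 f) x :=
    (hf.iteratedFDeriv_right (m := 0) (i := 2) (by simp)).continuousAt
  have h2 : ∀ i j, ContinuousAt (fun y => hessMatrix f y i j) x := by
    intro i j
    have := (ContinuousMultilinearMap.apply ℝ (fun _ : Fin 2 => EucSp n) ℝ
      ![EuclideanSpace.single i 1, EuclideanSpace.single j 1]).continuous.continuousAt.comp h1
    exact this
  refine tendsto_subtype_rng.2 ?_
  refine continuousAt_pi.2 fun i => continuousAt_pi.2 fun j => ?_
  exact ((h2 i j).add (h2 j i)).const_mul _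

lemma hessS_comp {f : EucSp n → ℝ} (c : ℝ) (b x : EucSp n)
    (hf : ContDiffAt ℝ 2 f (c • x + b)) :
    hessS (fun y => f (c • y + b)) x = c ^ 2 • hessS f (c • x + b) := by
  set A : EucSp n →L[ℝ] EucSp n := c • ContinuousLinearMap.id ℝ (EucSp n) with hA
  have hd : ∀ y : EucSp n, HasFDerivAt (fun y : EucSp n => c • y + b) A y := fun y =>
    ((hasFDerivAt_id y).const_smul c).add_const b
  have h1 : ∀ᶠ y in 𝓝 x, ContDiffAt ℝ 2 f (c • y + b) :=
    (hd x).continuousAt.eventually (hf.eventually (by simp))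
  have h2 : (fderiv ℝ fun y => f (c • y + b)) =ᶠ[𝓝 x] fun y => c • fderiv ℝ f (c • y + b) := by
    filter_upwards [h1] with y hy
    have := ((hy.differentiableAt (by simp)).hasFDerivAt.comp y (hd y)).fderiv
    change fderiv ℝ (f ∘ fun y => c • y + b) y = _
    rw [this]; ext v; simp [hA]
  have h3 : HasFDerivAt (fderiv ℝ f) (fderiv ℝ (fderiv ℝ f) (c • x + b)) (c • x + b) :=
    ((hf.fderiv_right (m := 1) (by norm_num)).differentiableAt (by simp)).hasFDerivAt
  have h4 := ((h3.comp x (hd x)).const_smul c).fderiv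
  have h5 : ∀ i j, hessMatrix (fun y => f (c • y + b)) x i j
      = c ^ 2 * hessMatrix f (c • x + b) i j := by
    intro i j
    rw [hessMatrix_apply, hessMatrix_apply, h2.fderiv_eq]
    change fderiv ℝ (c • (fderiv ℝ f ∘ fun y => c • y + b)) x _ _ = _
    rw [h4]; simp [hA]; ring
  apply symMat_ext
  intro i j
  simp [hessS, h5]; ring

lemma hessS_normSq (a x : EucSp n) : hessS (fun y => ‖y - a‖ ^ 2) x = (2 : ℝ) • 1 := by
  have h1 : (fderiv ℝ fun y : EucSp n => ‖y - a‖ ^ 2) = fun y => (2:ℝ) • innerSL ℝ (y - a) := by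
    funext y
    have := ((hasFDerivAt_id y).sub_const a).norm_sq.fderiv
    simp only [id] at this
    rw [this]; ext v; simp
  have h2 : HasFDerivAt (fun y : EucSp n => (2:ℝ) • innerSL ℝ (y - a)) ((2:ℝ) • innerSL ℝ) x := by
    have := ((innerSL ℝ (E := EucSp n)).hasFDerivAt (x := x - a)).comp x
      ((hasFDerivAt_id x).sub_const a)
    exact (this.congr_fderiv (by ext; rfl)).const_smul (2 : ℝ)
  have h3 : ∀ u w : EucSp n, fderiv ℝ (fun y : EucSp n => (2:ℝ) • innerSL ℝ (y - a)) x u w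
      = 2 * inner ℝ u w := fun u w => by rw [h2.fderiv]; rfl
  apply symMat_ext
  intro i j
  simp only [hessS, Matrix.smul_apply, Matrix.add_apply, Matrix.transpose_apply, hessMatrix_apply,
    h1, h3]
  by_cases hij : i = j
  · subst hij; simp; norm_num
  · simp [hij, Ne.symm hij, EuclideanSpace.inner_single_left]

/-- The quadratic form of a symmetric matrix. -/
def qf (A : SymMat n) (v : EucSp n) : ℝ :=
  ∑ i, ∑ j, (A : Matrix (Fin n) (Fin n) ℝ) i j * (v i * v j)

lemma posSemidef_iff_qf (A : SymMat n) :
    (A : Matrix (Fin n) (Fin n) ℝ).PosSemidef ↔ ∀ v, 0 ≤ qf A v := by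
  have hA : (A : Matrix (Fin n) (Fin n) ℝ).IsHermitian := A.2
  rw [Matrix.posSemidef_iff_dotProduct_mulVec]
  have key : ∀ v : Fin n → ℝ, star v ⬝ᵥ (A : Matrix (Fin n) (Fin n) ℝ).mulVec v
      = qf A (WithLp.toLp 2 v) := by
    intro v
    simp only [dotProduct, Matrix.mulVec, qf, Finset.mul_sum, Pi.star_apply, star_trivial]
    exact Finset.sum_congr rfl fun i _ => Finset.sum_congr rfl fun j _ => by ring
  constructor
  · rintro ⟨-, h⟩ v
    have := h v.ofLp
    rwa [key] at this
  · intro h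
    exact ⟨hA, fun v => by rw [key]; exact h _⟩

lemma qf_hessS {f : EucSp n → ℝ} {x : EucSp n} (hf : ContDiffAt ℝ 2 f x) (v : EucSp n) :
    qf (hessS f x) v = fderiv ℝ (fderiv ℝ f) x v v := by
  have hv : v = ∑ i, v i • EuclideanSpace.single i (1 : ℝ) := by
    ext i
    simp [Finset.sum_apply, Pi.single_apply]
  conv_rhs => rw [hv]
  simp only [map_sum, map_smul, _root_.sum_apply, _root_.smul_apply, qf,
    hessS_coe hf, hessMatrix_apply, smul_eq_mul, Finset.mul_sum]
  refine Finset.sum_comm.trans (Finset.sum_congr rfl fun i _ =>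
    Finset.sum_congr rfl fun j _ => by ring)

lemma taylor_two {f : EucSp n → ℝ} {x : EucSp n} (hf : ContDiffAt ℝ 2 f x) {ε : ℝ} (hε : 0 < ε) :
    ∀ᶠ y in 𝓝 x, |f y - (f x + fderiv ℝ f x (y - x) + 1 / 2 * qf (hessS f x) (y - x))|
      ≤ ε * ‖y - x‖ ^ 2 := by
  set D := fderiv ℝ f x
  set B := fderiv ℝ (fderiv ℝ f) x with hB
  have hsymm : IsSymmSndFDerivAt ℝ f x := hf.isSymmSndFDerivAt (by simp)
  have h3 : HasFDerivAt (fderiv ℝ f) B x :=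
    ((hf.fderiv_right (m := 1) (by norm_num)).differentiableAt (by simp)).hasFDerivAt
  have h1 : ∀ᶠ y in 𝓝 x, ‖fderiv ℝ f y - D - B (y - x)‖ ≤ ε * ‖y - x‖ :=
    (h3.isLittleO).def hε
  have h2 : ∀ᶠ y in 𝓝 x, ContDiffAt ℝ 2 f y := hf.eventually (by simp)
  obtain ⟨r, hr, hball⟩ := Metric.eventually_nhds_iff_ball.1 (h1.and h2)
  filter_upwards [Metric.ball_mem_nhds x hr] with y hy
  set g : EucSp n → ℝ := fun z => f z - (D (z - x) + 1 / 2 * B (z - x) (z - x)) with hg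
  have hsub : Metric.closedBall x (dist y x) ⊆ Metric.ball x r :=
    Metric.closedBall_subset_ball hy
  have hgd : ∀ z ∈ Metric.closedBall x (dist y x),
      HasFDerivWithinAt g (fderiv ℝ f z - D - B (z - x)) (Metric.closedBall x (dist y x)) z := by
    intro z hz
    have hfz := ((hball z (hsub hz)).2.differentiableAt (by simp)).hasFDerivAt
    have hid : HasFDerivAt (fun z => z - x) (ContinuousLinearMap.id ℝ (EucSp n)) z :=
      (hasFDerivAt_id z).sub_const x
    have hDz := D.hasFDerivAt.comp z hid
    have hBz := ((B.hasFDerivAt.comp z hid).clm_apply hid).const_mul (1 / 2 : ℝ)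
    refine (HasFDerivAt.congr_fderiv (hfz.sub (hDz.add hBz)) ?_).hasFDerivWithinAt
    ext v
    have : B v (z - x) = B (z - x) v := hsymm v (z - x)
    have h7 : B v z - B v x = B z v - B x v := by simpa using this
    simp
    linarith
  have hbound : ∀ z ∈ Metric.closedBall x (dist y x),
      ‖fderiv ℝ f z - D - B (z - x)‖ ≤ ε * dist y x := by
    intro z hz
    refine (hball z (hsub hz)).1.trans ?_
    rw [← dist_eq_norm]
    exact mul_le_mul_of_nonneg_left hz hε.le
  have := (convex_closedBall x (dist y x)).norm_image_sub_le_of_norm_hasFDerivWithin_le hgd hbound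
    (Metric.mem_closedBall_self dist_nonneg) (Metric.mem_closedBall.2 le_rfl)
  rw [dist_eq_norm] at this
  simp only [hg, sub_self, map_zero, Real.norm_eq_abs] at this
  rw [qf_hessS hf]
  calc _ = |f y - (D (y - x) + 1 / 2 * (B (y - x)) (y - x)) - (f x - (0 + 1 / 2 * 0))| := by
        congr 1; ring
    _ ≤ _ := by simpa [sq, mul_assoc] using this

lemma qf_add (A B : SymMat n) (v : EucSp n) : qf (A + B) v = qf A v + qf B v := by
  simp [qf, add_mul, Finset.sum_add_distrib]

lemma qf_smul_mat (c : ℝ) (A : SymMat n) (v : EucSp n) : qf (c • A) v = c * qf A v := by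
  simp [qf, Finset.mul_sum, mul_assoc]

lemma qf_smul (A : SymMat n) (t : ℝ) (v : EucSp n) : qf A (t • v) = t ^ 2 * qf A v := by
  simp only [qf, Finset.mul_sum, PiLp.smul_apply, smul_eq_mul]
  exact Finset.sum_congr rfl fun i _ => Finset.sum_congr rfl fun j _ => by ring

lemma qf_neg (A : SymMat n) (v : EucSp n) : qf (-A) v = - qf A v := by
  simp [qf]

lemma qf_one (v : EucSp n) : qf (1 : SymMat n) v = ‖v‖ ^ 2 := by
  rw [EuclideanSpace.real_norm_sq_eq]
  simp [qf, Matrix.one_apply, sq]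

/-- At a local maximum the Hessian is negative semidefinite. -/
lemma hessS_nonpos_of_isLocalMax {f : EucSp n → ℝ} {x : EucSp n} (hf : ContDiffAt ℝ 2 f x)
    (hmax : IsLocalMax f x) : ((-hessS f x : SymMat n) : Matrix (Fin n) (Fin n) ℝ).PosSemidef := by
  rw [posSemidef_iff_qf]
  intro v
  rw [qf_neg]
  have hD : fderiv ℝ f x = 0 := hmax.fderiv_eq_zero
  by_contra hcon
  push Not at hcon
  set q := qf (hessS f x) v with hq
  have hqpos : 0 < q := by linarith
  have hε : 0 < q / (4 * (‖v‖ ^ 2 + 1)) := by positivity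
  have hlim : Tendsto (fun t : ℝ => x + t • v) (𝓝[>] 0) (𝓝 x) := by
    have : ContinuousAt (fun t : ℝ => x + t • v) 0 := by fun_prop
    have h := this.tendsto
    simp only [zero_smul, add_zero] at h
    exact h.mono_left nhdsWithin_le_nhds
  obtain ⟨t, ⟨h1, h2⟩, ht⟩ := ((hlim.eventually ((taylor_two hf hε).and hmax)).and
    self_mem_nhdsWithin).exists
  simp only [add_sub_cancel_left, hD, qf_smul, norm_smul] at h1
  have ht : 0 < t := ht
  have h3 := (abs_le.1 h1).1
  have h4 : q / (4 * (‖v‖ ^ 2 + 1)) * (‖t‖ * ‖v‖) ^ 2 ≤ t ^ 2 * q / 4 := by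
    rw [mul_pow, Real.norm_eq_abs, sq_abs, div_mul_eq_mul_div,
      div_le_div_iff₀ (by positivity) (by norm_num)]
    have : 0 < t ^ 2 * q := by positivity
    nlinarith [sq_nonneg ‖v‖]
  have h5 : 0 < t ^ 2 * q := by positivity
  have h2 : f (x + t • v) ≤ f x := h2
  rw [zero_apply, add_zero, ← hq] at h3
  linarith

instance symMat_continuousSMul : ContinuousSMul ℝ (SymMat n) :=
  ⟨Continuous.subtype_mk (continuous_fst.smul (continuous_subtype_val.comp continuous_snd)) _⟩

instance symMat_locallyConvexSpace : LocallyConvexSpace ℝ (SymMat n) := by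
  let f : SymMat n →ₗ[ℝ] (Fin n → Fin n → ℝ) :=
    { toFun := fun A => A.1
      map_add' := fun _ _ => rfl
      map_smul' := fun _ _ => rfl }
  exact LocallyConvexSpace.induced f

/-- Viscosity condition at a single point, for real-valued functions. -/
def SubAt (S : Set (SymMat n)) (u : EucSp n → ℝ) (x : EucSp n) : Prop :=
  ∀ ψ : EucSp n → ℝ, ContDiffAt ℝ 2 ψ x → (∀ᶠ y in 𝓝 x, u y ≤ ψ y) → u x = ψ x →
    hessS ψ x ∈ S

/-- Stability under addition of positive semidefinite matrices. -/
def IsPosSet (S : Set (SymMat n)) : Prop :=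
  ∀ A ∈ S, ∀ P : SymMat n, (P : Matrix (Fin n) (Fin n) ℝ).PosSemidef → A + P ∈ S

lemma fSubharmonicOn_iff {S : Set (SymMat n)} {X : Set (EucSp n)} (hX : IsOpen X)
    {u : EucSp n → ℝ} (hu : ContinuousOn u X) :
    FSubharmonicOn S X (fun y => (u y : EReal)) ↔ ∀ x ∈ X, SubAt S u x := by
  have htest : ∀ x ∈ X, ∀ ψ : EucSp n → ℝ, IsTestAt X (fun y => (u y : EReal)) ψ x ↔
      ContDiffAt ℝ 2 ψ x ∧ (∀ᶠ y in 𝓝 x, u y ≤ ψ y) ∧ u x = ψ x := by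
    intro x hx ψ
    simp only [IsTestAt, hX.nhdsWithin_eq hx, EReal.coe_le_coe_iff, EReal.coe_eq_coe_iff]
  constructor
  · rintro ⟨-, -, h⟩ x hx ψ h1 h2 h3
    exact (hessMatrix_mem_iff h1 S).1 (h x hx ψ ((htest x hx ψ).2 ⟨h1, h2, h3⟩))
  · intro h
    refine ⟨?_, fun x _ => EReal.coe_ne_top _, fun x hx ψ hψ => ?_⟩
    · exact (continuous_coe_real_ereal.comp_continuousOn hu).upperSemicontinuousOn
    · obtain ⟨h1, h2, h3⟩ := (htest x hx ψ).1 hψ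
      exact (hessMatrix_mem_iff h1 S).2 (h x hx ψ h1 h2 h3)

lemma fHarmonicOn_iff {F : ConeSubequation n} {X : Set (EucSp n)} (hX : IsOpen X)
    {u : EucSp n → ℝ} (hu : ContinuousOn u X) :
    FHarmonicOn F X (fun y => (u y : EReal)) ↔
      ∀ x ∈ X, SubAt F.carrier u x ∧ SubAt (dualSet F.carrier) (fun y => - u y) x := by
  have h2 := fSubharmonicOn_iff (S := dualSet F.carrier) hX hu.neg
  simp only [EReal.coe_neg, Pi.neg_apply] at h2
  rw [FHarmonicOn, fSubharmonicOn_iff hX hu, h2, ← forall₂_and]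
  rfl

lemma SubAt.mono_fun {S : Set (SymMat n)} {u v : EucSp n → ℝ} {x : EucSp n} (hv : SubAt S v x)
    (hle : ∀ᶠ y in 𝓝 x, v y ≤ u y) (heq : v x = u x) : SubAt S u x := fun ψ h1 h2 h3 =>
  hv ψ h1 (by filter_upwards [hle, h2] with y hy hy' using hy.trans hy') (heq.trans h3)

lemma SubAt.congr {S : Set (SymMat n)} {u v : EucSp n → ℝ} {x : EucSp n} (hv : SubAt S v x)
    (h : v =ᶠ[𝓝 x] u) : SubAt S u x :=
  hv.mono_fun h.le h.eq_of_nhds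

lemma SubAt.mono_set {S T : Set (SymMat n)} {u : EucSp n → ℝ} {x : EucSp n} (hu : SubAt S u x)
    (hST : S ⊆ T) : SubAt T u x := fun ψ h1 h2 h3 => hST (hu ψ h1 h2 h3)

/-- The maximum of two functions satisfies the viscosity condition wherever each of them does at
the points where it realizes the maximum. -/
lemma SubAt.max {S : Set (SymMat n)} {u v : EucSp n → ℝ} {x : EucSp n}
    (hu : v x ≤ u x → SubAt S u x) (hv : u x ≤ v x → SubAt S v x) :
    SubAt S (fun y => max (u y) (v y)) x := by
  rcases le_total (v x) (u x) with h | h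
  · exact (hu h).mono_fun (Eventually.of_forall fun y => le_max_left _ _) (max_eq_left h).symm
  · exact (hv h).mono_fun (Eventually.of_forall fun y => le_max_right _ _) (max_eq_right h).symm

lemma SubAt.hessS_mem_of_isLocalMax {S : Set (SymMat n)} {u f : EucSp n → ℝ} {x : EucSp n}
    (hu : SubAt S u x) (hf : ContDiffAt ℝ 2 f x) (hmax : IsLocalMax (fun y => u y - f y) x) :
    hessS f x ∈ S := by
  have h := hu (fun y => f y + (u x - f x)) (hf.add contDiffAt_const) ?_ (by ring)
  · rwa [hessS_add hf contDiffAt_const, hessS_const, add_zero] at h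
  · filter_upwards [hmax] with y hy
    have : u y - f y ≤ u x - f x := hy
    linarith

lemma subAt_of_hessS_mem {S : Set (SymMat n)} (hS : IsPosSet S) {f : EucSp n → ℝ} {x : EucSp n}
    (hf : ContDiffAt ℝ 2 f x) (h : hessS f x ∈ S) : SubAt S f x := by
  intro ψ h1 h2 h3
  have hmax : IsLocalMax (fun y => f y + -ψ y) x := by
    filter_upwards [h2] with y hy
    rw [h3]; linarith
  have := hessS_nonpos_of_isLocalMax (hf.add h1.neg) hmax
  rw [hessS_add hf h1.neg, hessS_neg h1] at this
  have h4 := hS _ h _ this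
  simpa using h4

lemma SubAt.add_const {S : Set (SymMat n)} {u : EucSp n → ℝ} {x : EucSp n} (hu : SubAt S u x)
    (c : ℝ) : SubAt S (fun y => u y + c) x := by
  intro ψ h1 h2 h3
  refine hu.hessS_mem_of_isLocalMax h1 ?_
  filter_upwards [h2] with y hy
  linarith

lemma SubAt.const_mul {S : Set (SymMat n)} (hS : ∀ A ∈ S, ∀ t : ℝ, 0 < t → t • A ∈ S)
    {u : EucSp n → ℝ} {x : EucSp n} (hu : SubAt S u x) {t : ℝ} (ht : 0 < t) :
    SubAt S (fun y => t * u y) x := by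
  intro ψ h1 h2 h3
  have hψ : ContDiffAt ℝ 2 (fun y => t⁻¹ * ψ y) x := contDiffAt_const.mul h1
  have h := hu _ hψ ?_ ?_
  · rw [hessS_smul _ h1] at h
    have := hS _ h t ht
    rwa [smul_smul, mul_inv_cancel₀ ht.ne', one_smul] at this
  · filter_upwards [h2] with y hy
    rw [inv_mul_eq_div, le_div_iff₀ ht]; linarith
  · rw [inv_mul_eq_div, eq_div_iff ht.ne']; linarith

lemma SubAt.comp_affine {S : Set (SymMat n)} {u : EucSp n → ℝ} {c : ℝ} (hc : c ≠ 0)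
    (hS : ∀ A ∈ S, c ^ 2 • A ∈ S) {b x : EucSp n} (hu : SubAt S u (c • x + b)) :
    SubAt S (fun y => u (c • y + b)) x := by
  intro ψ h1 h2 h3
  set b' : EucSp n := -(c⁻¹ • b)
  have hinv : ∀ y : EucSp n, c⁻¹ • (c • y + b) + b' = y := by
    intro y; simp [b', smul_smul, hc]
  have hinv' : ∀ y : EucSp n, c • (c⁻¹ • y + b') + b = y := by
    intro y; simp [b', smul_smul, hc]
  have h1' : ContDiffAt ℝ 2 ψ (c⁻¹ • (c • x + b) + b') := by rwa [hinv]
  have hcomp : ContDiffAt ℝ 2 (fun y => ψ (c⁻¹ • y + b')) (c • x + b) :=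
    h1'.comp (c • x + b) (by fun_prop)
  have h := hu (fun y => ψ (c⁻¹ • y + b')) hcomp ?_ ?_
  · rw [hessS_comp _ _ _ h1', hinv] at h
    have := hS _ h
    rwa [smul_smul, ← mul_pow, mul_inv_cancel₀ hc, one_pow, one_smul] at this
  · have hcont : Tendsto (fun y : EucSp n => c⁻¹ • y + b') (𝓝 (c • x + b)) (𝓝 x) := by
      have : ContinuousAt (fun y : EucSp n => c⁻¹ • y + b') (c • x + b) := by fun_prop
      have h := this.tendsto
      rwa [hinv] at h
    filter_upwards [hcont.eventually h2] with y hy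
    rwa [hinv'] at hy
  · rw [hinv]; exact h3

lemma exists_isLocalMax_of_compact {K X : Set (EucSp n)} (hK : IsCompact K) (hX : IsOpen X)
    (hXK : X ⊆ K) {g : EucSp n → ℝ} (hg : ContinuousOn g K) {y₀ : EucSp n} (hy₀ : y₀ ∈ K)
    (hlt : ∀ y ∈ K, y ∉ X → g y < g y₀) : ∃ y ∈ X, IsLocalMax g y ∧ g y₀ ≤ g y := by
  obtain ⟨y, hyK, hy⟩ := hK.exists_isMaxOn ⟨y₀, hy₀⟩ hg
  have hyX : y ∈ X := by
    by_contra hcon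
    exact absurd (hy hy₀) (not_le.2 (hlt y hyK hcon))
  exact ⟨y, hyX, (hy.on_subset hXK).isLocalMax (hX.mem_nhds hyX), hy hy₀⟩

lemma posSemidef_smul_one_add_eventually {c : ℝ} (hc : 0 < c) :
    ∀ᶠ N : SymMat n in 𝓝 0, ((c • 1 + N : SymMat n) : Matrix (Fin n) (Fin n) ℝ).PosSemidef := by
  have hs : 0 < c / (n ^ 2 + 1) := by positivity
  have h : ∀ i j : Fin n, ∀ᶠ N : SymMat n in 𝓝 0,
      |(N : Matrix (Fin n) (Fin n) ℝ) i j| < c / (n ^ 2 + 1) := by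
    intro i j
    have hcont : Continuous fun N : SymMat n => |(N : Matrix (Fin n) (Fin n) ℝ) i j| :=
      (continuous_subtype_val.matrix_elem i j).abs
    exact hcont.continuousAt.eventually_lt_const (by simpa using hs)
  filter_upwards [eventually_all.2 fun i => eventually_all.2 (h i)] with N hN
  rw [posSemidef_iff_qf]
  intro v
  rw [qf_add, qf_smul_mat, qf_one]
  have hcoord : ∀ i, |v i| ≤ ‖v‖ := fun i => by simpa using PiLp.norm_apply_le v i
  have hb : |qf N v| ≤ ∑ _i : Fin n, ∑ _j : Fin n, c / (n ^ 2 + 1) * ‖v‖ ^ 2 := by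
    refine (Finset.abs_sum_le_sum_abs _ _).trans (Finset.sum_le_sum fun i _ =>
      (Finset.abs_sum_le_sum_abs _ _).trans (Finset.sum_le_sum fun j _ => ?_))
    rw [abs_mul, abs_mul, sq ‖v‖]
    have h1 := (hN i j).le
    have h2 := mul_le_mul (hcoord i) (hcoord j) (abs_nonneg _) (norm_nonneg _)
    have h3 := mul_le_mul h1 h2 (by positivity) hs.le
    linarith [h3]
  simp only [Finset.sum_const, Finset.card_univ, Fintype.card_fin, nsmul_eq_mul] at hb
  have h1 : (n : ℝ) * (n * (c / (n ^ 2 + 1) * ‖v‖ ^ 2)) ≤ c * ‖v‖ ^ 2 := by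
    have : (n : ℝ) * (n * (c / (n ^ 2 + 1) * ‖v‖ ^ 2)) = (n ^ 2 / (n ^ 2 + 1)) * (c * ‖v‖ ^ 2) := by
      field_simp
    rw [this]
    apply mul_le_of_le_one_left (by positivity)
    rw [div_le_one (by positivity)]; linarith
  linarith [(abs_le.1 hb).1]

namespace ConeSubequation

variable (F : ConeSubequation n)

lemma isPosSet : IsPosSet F.carrier := F.f1

lemma zero_mem : (0 : SymMat n) ∈ F.carrier := by
  obtain ⟨A, hA⟩ := F.nonempty'
  have hlim : Tendsto (fun t : ℝ => t • A) (𝓝[>] 0) (𝓝 0) := by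
    have : ContinuousAt (fun t : ℝ => t • A) 0 := by fun_prop
    have h := this.tendsto
    rw [zero_smul] at h
    exact h.mono_left nhdsWithin_le_nhds
  exact F.isClosed'.mem_of_tendsto hlim (eventually_mem_nhdsWithin.mono fun t ht => F.f2 A hA t ht)

lemma posSemidef_mem {P : SymMat n} (hP : (P : Matrix (Fin n) (Fin n) ℝ).PosSemidef) :
    P ∈ F.carrier := by
  simpa using F.f1 0 F.zero_mem P hP

lemma add_smul_one_mem_interior {A : SymMat n} (hA : A ∈ F.carrier) {c : ℝ} (hc : 0 < c) :
    A + c • 1 ∈ interior F.carrier := by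
  rw [mem_interior_iff_mem_nhds]
  have hlim : Tendsto (fun B : SymMat n => B - (A + c • 1)) (𝓝 (A + c • 1)) (𝓝 0) := by
    have : ContinuousAt (fun B : SymMat n => B - (A + c • 1)) (A + c • 1) := by fun_prop
    have h := this.tendsto
    rwa [sub_self] at h
  filter_upwards [hlim.eventually (posSemidef_smul_one_add_eventually hc)] with B hB
  have := F.f1 A hA _ hB
  convert this using 1
  abel

lemma interior_add {A P : SymMat n} (hA : A ∈ interior F.carrier)
    (hP : (P : Matrix (Fin n) (Fin n) ℝ).PosSemidef) : A + P ∈ interior F.carrier := by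
  rw [mem_interior_iff_mem_nhds] at hA ⊢
  have hlim : Tendsto (fun B : SymMat n => B - P) (𝓝 (A + P)) (𝓝 A) := by
    have : ContinuousAt (fun B : SymMat n => B - P) (A + P) := by fun_prop
    have h := this.tendsto
    rwa [add_sub_cancel_right] at h
  filter_upwards [hlim hA] with B hB
  simpa using F.f1 _ hB P hP

lemma zero_notMem_interior : (0 : SymMat n) ∉ interior F.carrier := by
  intro h0
  rw [mem_interior_iff_mem_nhds] at h0
  apply F.proper'
  rw [Set.eq_univ_iff_forall]
  intro A
  have hlim : Tendsto (fun t : ℝ => t • A) (𝓝[>] 0) (𝓝 0) := by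
    have : ContinuousAt (fun t : ℝ => t • A) 0 := by fun_prop
    have h := this.tendsto
    rw [zero_smul] at h
    exact h.mono_left nhdsWithin_le_nhds
  obtain ⟨t, ht, ht0⟩ := ((hlim.eventually h0).and eventually_mem_nhdsWithin).exists
  have := F.f2 _ ht t⁻¹ (inv_pos.2 ht0)
  rwa [smul_smul, inv_mul_cancel₀ (ne_of_gt ht0), one_smul] at this

lemma smul_mem_interior {A : SymMat n} (hA : A ∈ interior F.carrier) {t : ℝ} (ht : 0 < t) :
    t • A ∈ interior F.carrier := by
  rw [mem_interior_iff_mem_nhds] at hA ⊢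
  have hlim : Tendsto (fun B : SymMat n => t⁻¹ • B) (𝓝 (t • A)) (𝓝 A) := by
    have : ContinuousAt (fun B : SymMat n => t⁻¹ • B) (t • A) := by fun_prop
    have h := this.tendsto
    rwa [smul_smul, inv_mul_cancel₀ ht.ne', one_smul] at h
  filter_upwards [hlim hA] with B hB
  have := F.f2 _ hB t ht
  rwa [smul_smul, mul_inv_cancel₀ ht.ne', one_smul] at this

lemma isPosSet_dualSet : IsPosSet (dualSet F.carrier) := by
  intro A hA P hP h
  apply hA
  have := F.interior_add h hP
  simpa using this

lemma dualSet_smul_mem : ∀ A ∈ dualSet F.carrier, ∀ t : ℝ, 0 < t → t • A ∈ dualSet F.carrier := by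
  intro A hA t ht h
  apply hA
  have := F.smul_mem_interior h (inv_pos.2 ht)
  rwa [smul_neg, smul_smul, inv_mul_cancel₀ ht.ne', one_smul] at this

lemma subAt_dualSet_const (c : ℝ) (x : EucSp n) : SubAt (dualSet F.carrier) (fun _ => c) x :=
  subAt_of_hessS_mem F.isPosSet_dualSet contDiffAt_const (by
    rw [hessS_const]
    change -(0 : SymMat n) ∉ _
    rw [neg_zero]
    exact F.zero_notMem_interior)

end ConeSubequation

/-- An upper envelope of functions satisfying the viscosity condition satisfies it. -/
lemma subAt_of_approx {S : Set (SymMat n)} (hS : IsClosed S) {G : EucSp n → ℝ} {x : EucSp n}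
    {U : Set (EucSp n)} (hU : U ∈ 𝓝 x)
    (happrox : ∀ ε : ℝ, 0 < ε → ∃ u : EucSp n → ℝ, Continuous u ∧ (∀ y ∈ U, SubAt S u y) ∧
      (∀ y, u y ≤ G y) ∧ G x - ε < u x) : SubAt S G x := by
  intro ψ h1 h2 h3
  have key : ∀ η : ℝ, 0 < η → hessS ψ x + (2 * η) • 1 ∈ S := by
    intro η hη
    have hfreq : ∃ᶠ y in 𝓝 x, hessS ψ y + (2 * η) • 1 ∈ S := by
      rw [Metric.nhds_basis_ball.frequently_iff]
      intro r hr
      obtain ⟨s, hs, hball⟩ := Metric.eventually_nhds_iff_ball.1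
        (h2.and ((h1.eventually (by simp)).and (eventually_mem_set.2 hU)))
      set ρ := min r s / 2 with hρ
      have hρ0 : 0 < ρ := by positivity
      have hρr : ρ < r := (half_lt_self (lt_min hr hs)).trans_le (min_le_left _ _)
      have hρs : ρ < s := (half_lt_self (lt_min hr hs)).trans_le (min_le_right _ _)
      obtain ⟨u, huc, hu, huG, hux⟩ := happrox (η * ρ ^ 2) (by positivity)
      have hψC : ContinuousOn ψ (Metric.closedBall x ρ) := fun y hy =>
        (hball y (Metric.closedBall_subset_ball hρs hy)).2.1.continuousAt.continuousWithinAt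
      obtain ⟨y, hy, hymax, -⟩ := exists_isLocalMax_of_compact (isCompact_closedBall x ρ)
        Metric.isOpen_ball Metric.ball_subset_closedBall
        (g := fun y => u y - (ψ y + η * ‖y - x‖ ^ 2))
        (huc.continuousOn.sub (hψC.add (by fun_prop))) (y₀ := x)
        (Metric.mem_closedBall_self hρ0.le) (by
          intro y hy hy'
          have hd : ‖y - x‖ = ρ := by
            rw [← dist_eq_norm]
            exact le_antisymm hy (not_lt.1 hy')
          have := (hball y (Metric.closedBall_subset_ball hρs hy)).1
          have := huG y
          simp only [hd, sub_self, norm_zero]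
          nlinarith)
      refine ⟨y, Metric.ball_subset_ball hρr.le hy, ?_⟩
      obtain ⟨-, hψy, hyU⟩ := hball y (Metric.ball_subset_ball hρs.le hy)
      have hsq : ContDiffAt ℝ 2 (fun y => ‖y - x‖ ^ 2) y :=
        ((contDiff_id.sub contDiff_const).norm_sq ℝ).contDiffAt
      have := (hu y hyU).hessS_mem_of_isLocalMax (hψy.add (contDiffAt_const.mul hsq)) hymax
      rwa [hessS_add hψy (contDiffAt_const.mul hsq), hessS_smul η hsq, hessS_normSq, smul_smul,
        mul_comm η 2] at this
    exact hS.mem_of_frequently_of_tendsto hfreq ((hessS_continuousAt h1).add_const _).tendsto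
  have hlim : Tendsto (fun η : ℝ => hessS ψ x + (2 * η) • (1 : SymMat n)) (𝓝[>] 0)
      (𝓝 (hessS ψ x)) := by
    have : ContinuousAt (fun η : ℝ => hessS ψ x + (2 * η) • (1 : SymMat n)) 0 := by fun_prop
    have h := this.tendsto
    rw [mul_zero, zero_smul, add_zero] at h
    exact h.mono_left nhdsWithin_le_nhds
  exact hS.mem_of_tendsto hlim (eventually_mem_nhdsWithin.mono fun η hη => key η hη)

/-- Maximum principle for the second order operator defined by `ℓ`. -/
lemma le_on_ball_of_linear (ℓ : SymMat n →L[ℝ] ℝ) (hℓ : 0 < ℓ 1) {u q : EucSp n → ℝ}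
    (huc : ContinuousOn u (Metric.closedBall 0 1))
    (hu : ∀ y ∈ Metric.ball (0 : EucSp n) 1, SubAt {A | 0 ≤ ℓ A} u y)
    (hq : ContDiff ℝ 2 q) (hL : ∀ y, ℓ (hessS q y) = 0)
    (hle : ∀ y ∈ Metric.sphere (0 : EucSp n) 1, u y ≤ q y) :
    ∀ y ∈ Metric.closedBall (0 : EucSp n) 1, u y ≤ q y := by
  intro y₀ hy₀
  by_contra! hcon
  set d := u y₀ - q y₀ with hd
  have hd0 : 0 < d := sub_pos.2 hcon
  obtain ⟨y, hy, hymax, -⟩ := exists_isLocalMax_of_compact (isCompact_closedBall (0 : EucSp n) 1)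
    Metric.isOpen_ball Metric.ball_subset_closedBall
    (g := fun y => u y - (q y + (-(d / 2)) * ‖y - 0‖ ^ 2))
    (huc.sub (hq.continuous.continuousOn.add (by fun_prop))) hy₀ (by
      intro y hy hy'
      have h1 : ‖y - 0‖ = 1 := by
        rw [← dist_eq_norm]
        exact le_antisymm hy (not_lt.1 hy')
      have h2 := hle y (by rwa [mem_sphere_iff_norm])
      rw [h1]
      have : 0 ≤ d / 2 * ‖y₀ - 0‖ ^ 2 := by positivity
      linarith)
  have hsq : ContDiffAt ℝ 2 (fun y : EucSp n => ‖y - 0‖ ^ 2) y :=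
    ((contDiff_id.sub contDiff_const).norm_sq ℝ).contDiffAt
  have h := (hu y hy).hessS_mem_of_isLocalMax (hq.contDiffAt.add (contDiffAt_const.mul hsq)) hymax
  rw [hessS_add hq.contDiffAt (contDiffAt_const.mul hsq), hessS_smul _ hsq, hessS_normSq] at h
  change 0 ≤ ℓ _ at h
  rw [map_add, hL, map_smul, map_smul, smul_eq_mul, smul_eq_mul] at h
  nlinarith

section Polynomials

open MvPolynomial

/-- The function on Euclidean space defined by a polynomial. -/
def polyFun (p : MvPolynomial (Fin n) ℝ) (x : EucSp n) : ℝ := eval (fun i => x i) p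

lemma polyFun_C (a : ℝ) : polyFun (C a : MvPolynomial (Fin n) ℝ) = fun _ => a := by
  funext y; simp [polyFun]

lemma polyFun_add (p q : MvPolynomial (Fin n) ℝ) :
    polyFun (p + q) = polyFun p + polyFun q := by
  funext y; simp [polyFun]

lemma polyFun_mul (p q : MvPolynomial (Fin n) ℝ) :
    polyFun (p * q) = polyFun p * polyFun q := by
  funext y; simp [polyFun]

lemma polyFun_X (i : Fin n) : polyFun (X i : MvPolynomial (Fin n) ℝ) = fun x => x i := by
  funext y; simp [polyFun]

lemma contDiff_polyFun (p : MvPolynomial (Fin n) ℝ) : ContDiff ℝ 2 (polyFun p) := by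
  induction p using MvPolynomial.induction_on with
  | C a => rw [polyFun_C]; exact contDiff_const
  | add p q hp hq => rw [polyFun_add]; exact hp.add hq
  | mul_X p i hp =>
    have : ContDiff ℝ 2 fun x : EucSp n => x i := by fun_prop
    rw [polyFun_mul, polyFun_X]
    exact hp.mul this

lemma hasFDerivAt_polyFun (p : MvPolynomial (Fin n) ℝ) (x : EucSp n) :
    HasFDerivAt (polyFun p)
      (∑ i, polyFun (pderiv i p) x • (EuclideanSpace.proj i : EucSp n →L[ℝ] ℝ)) x := by
  induction p using MvPolynomial.induction_on with
  | C a =>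
    rw [polyFun_C]
    refine (hasFDerivAt_const a x).congr_fderiv ?_
    simp [polyFun]
  | add p q hp hq =>
    rw [polyFun_add]
    refine (hp.add hq).congr_fderiv ?_
    simp [polyFun, add_smul, Finset.sum_add_distrib]
  | mul_X p j hp =>
    have h1 : HasFDerivAt (fun x : EucSp n => x j) (EuclideanSpace.proj j : EucSp n →L[ℝ] ℝ) x :=
      (EuclideanSpace.proj j : EucSp n →L[ℝ] ℝ).hasFDerivAt
    have h2 := hp.mul h1
    have h3 : polyFun (p * X j) = fun x : EucSp n => polyFun p x * x j := by
      funext y; simp [polyFun]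
    rw [h3]
    refine h2.congr_fderiv ?_
    ext v
    simp [polyFun, Pi.single_apply, apply_ite, Finset.sum_add_distrib, Finset.mul_sum, add_mul,
      pderiv_X, ite_mul]
    exact Finset.sum_congr rfl fun i _ => by ring

lemma hessMatrix_polyFun (p : MvPolynomial (Fin n) ℝ) (x : EucSp n) (i j : Fin n) :
    hessMatrix (polyFun p) x i j = polyFun (pderiv i (pderiv j p)) x := by
  have h1 : fderiv ℝ (polyFun p) = fun x => ∑ i, polyFun (pderiv i p) x •
      (EuclideanSpace.proj i : EucSp n →L[ℝ] ℝ) := by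
    funext y; exact (hasFDerivAt_polyFun p y).fderiv
  have h2 : HasFDerivAt (fun x => ∑ i, polyFun (pderiv i p) x •
      (EuclideanSpace.proj i : EucSp n →L[ℝ] ℝ)) _ x :=
    HasFDerivAt.fun_sum fun i _ => (hasFDerivAt_polyFun (pderiv i p) x).smul_const
      (EuclideanSpace.proj i : EucSp n →L[ℝ] ℝ)
  rw [hessMatrix_apply, h1, h2.fderiv]
  simp

/-- The symmetrized matrix units. -/
def symUnit (i j : Fin n) : SymMat n :=
  ⟨(1 / 2 : ℝ) • (Matrix.single i j 1 + Matrix.single j i 1), by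
    rw [selfAdjoint.mem_iff, star_smul, star_add]
    simp [Matrix.star_eq_conjTranspose, add_comm]⟩

lemma hessS_polyFun (p : MvPolynomial (Fin n) ℝ) (x : EucSp n) :
    hessS (polyFun p) x = ∑ i, ∑ j, polyFun (pderiv i (pderiv j p)) x • symUnit i j := by
  apply Subtype.ext
  simp only [← hessMatrix_polyFun]
  ext a b
  simp [hessS, symUnit, Matrix.sum_apply, Matrix.single_apply, ite_and,
    Finset.sum_add_distrib]
  ring

/-- The constant coefficient second order operator `p ↦ ℓ(D²p)` on polynomials. -/
def polyOp (ℓ : SymMat n →L[ℝ] ℝ) : MvPolynomial (Fin n) ℝ →ₗ[ℝ] MvPolynomial (Fin n) ℝ :=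
  ∑ i, ∑ j, ℓ (symUnit i j) • ((pderiv i).toLinearMap ∘ₗ (pderiv j).toLinearMap)

lemma polyFun_polyOp (ℓ : SymMat n →L[ℝ] ℝ) (p : MvPolynomial (Fin n) ℝ) (x : EucSp n) :
    polyFun (polyOp ℓ p) x = ℓ (hessS (polyFun p) x) := by
  simp [hessS_polyFun, polyOp, polyFun, map_sum, smul_eval, mul_comm]

lemma totalDegree_pderiv_le (i : Fin n) (p : MvPolynomial (Fin n) ℝ) :
    (pderiv i p).totalDegree ≤ p.totalDegree - 1 := by
  conv_lhs => rw [← support_sum_monomial_coeff p, map_sum]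
  refine (totalDegree_finsetSum _ _).trans (Finset.sup_le fun s hs => ?_)
  rw [pderiv_monomial]
  by_cases h : s i = 0
  · simp [h]
  · refine (totalDegree_monomial_le _ _).trans ?_
    have h1 := le_totalDegree hs
    have h2 : Finsupp.single i 1 ≤ s := by
      rw [Finsupp.single_le_iff]; omega
    have h3 : (s - Finsupp.single i 1).degree + (Finsupp.single i 1).degree = s.degree := by
      rw [← map_add, tsub_add_cancel_of_le h2]
    have h4 : (s.sum fun _ e => e) = s.degree := rfl
    have h5 : ((s - Finsupp.single i 1).sum fun _ e => e) = (s - Finsupp.single i 1).degree := rfl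
    simp only [Finsupp.degree_single] at h3
    change ((s - Finsupp.single i 1).sum fun _ e => e) ≤ _
    omega

lemma totalDegree_polyOp_le (ℓ : SymMat n →L[ℝ] ℝ) (p : MvPolynomial (Fin n) ℝ) :
    (polyOp ℓ p).totalDegree ≤ p.totalDegree - 2 := by
  have : polyOp ℓ p = ∑ i, ∑ j, ℓ (symUnit i j) • pderiv i (pderiv j p) := by
    simp [polyOp]
  rw [this]
  refine (totalDegree_finsetSum _ _).trans (Finset.sup_le fun i _ =>
    (totalDegree_finsetSum _ _).trans (Finset.sup_le fun j _ => (totalDegree_smul_le _ _).trans ?_))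
  have h1 := totalDegree_pderiv_le i (pderiv j p)
  have h2 := totalDegree_pderiv_le j p
  omega

lemma eq_zero_of_polyFun_ball (p : MvPolynomial (Fin n) ℝ)
    (h : ∀ x ∈ Metric.ball (0 : EucSp n) 1, polyFun p x = 0) : p = 0 := by
  have hpos : (0 : ℝ) < 1 / (n + 1) := by positivity
  refine funext_set (fun _ => Set.Ioo 0 (1 / (n + 1 : ℝ))) (fun _ => Set.Ioo_infinite hpos)
    fun x hx => ?_
  have := h (WithLp.toLp 2 x) ?_
  · simpa [polyFun] using this
  · rw [mem_ball_zero_iff, ← sq_lt_one_iff₀ (norm_nonneg _), EuclideanSpace.real_norm_sq_eq]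
    have h1 : ∀ i ∈ Finset.univ, x i ^ 2 ≤ (1 / (n + 1 : ℝ)) ^ 2 := fun i _ => by
      have := hx i trivial
      exact pow_le_pow_left₀ this.1.le this.2.le 2
    refine (Finset.sum_le_sum h1).trans_lt ?_
    simp only [Finset.sum_const, Finset.card_univ, Fintype.card_fin, nsmul_eq_mul, one_div, inv_pow]
    rw [← div_eq_mul_inv, div_lt_one (by positivity)]
    nlinarith

lemma polyFun_le_of_harmonic (ℓ : SymMat n →L[ℝ] ℝ) (hℓ : 0 < ℓ 1)
    (hpos : IsPosSet {A : SymMat n | 0 ≤ ℓ A})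
    {p : MvPolynomial (Fin n) ℝ} (hp : polyOp ℓ p = 0) {c : ℝ}
    (hc : ∀ y ∈ Metric.sphere (0 : EucSp n) 1, polyFun p y ≤ c) :
    ∀ y ∈ Metric.closedBall (0 : EucSp n) 1, polyFun p y ≤ c := by
  refine le_on_ball_of_linear ℓ hℓ (contDiff_polyFun p).continuous.continuousOn (fun y _ =>
    subAt_of_hessS_mem hpos (contDiff_polyFun p).contDiffAt ?_) contDiff_const (fun y => ?_) hc
  · change 0 ≤ ℓ _
    rw [← polyFun_polyOp, hp]; simp [polyFun]
  · rw [hessS_const, map_zero]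

/-- Every polynomial agrees on the unit sphere with a polynomial solution of `ℓ(D²q) = 0`. -/
lemma exists_harmonic_polynomial (ℓ : SymMat n →L[ℝ] ℝ) (hℓ : 0 < ℓ 1)
    (hpos : IsPosSet {A : SymMat n | 0 ≤ ℓ A}) (p : MvPolynomial (Fin n) ℝ) :
    ∃ q : MvPolynomial (Fin n) ℝ, polyOp ℓ q = 0 ∧
      ∀ y ∈ Metric.sphere (0 : EucSp n) 1, polyFun q y = polyFun p y := by
  set m := p.totalDegree
  set w : MvPolynomial (Fin n) ℝ := 1 - ∑ i, X i ^ 2 with hw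
  have hwfun : ∀ x : EucSp n, polyFun w x = 1 - ‖x‖ ^ 2 := fun x => by
    simp [polyFun, hw, EuclideanSpace.real_norm_sq_eq]
  have hmul : ∀ r : MvPolynomial (Fin n) ℝ, ∀ x, polyFun (w * r) x = (1 - ‖x‖ ^ 2) * polyFun r x :=
    fun r x => by rw [← hwfun]; simp [polyFun]
  have hdeg : w.totalDegree ≤ 2 := by
    refine (totalDegree_sub _ _).trans (max_le (by simp) ?_)
    refine (totalDegree_finsetSum _ _).trans (Finset.sup_le fun i _ => ?_)
    simp
  let T : MvPolynomial (Fin n) ℝ →ₗ[ℝ] MvPolynomial (Fin n) ℝ :=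
    polyOp ℓ ∘ₗ LinearMap.mulLeft ℝ w
  have hT : ∀ r ∈ restrictTotalDegree (Fin n) ℝ m, T r ∈ restrictTotalDegree (Fin n) ℝ m := by
    intro r hr
    rw [mem_restrictTotalDegree] at hr ⊢
    have h1 := totalDegree_polyOp_le ℓ (w * r)
    have h2 := totalDegree_mul w r
    change (polyOp ℓ (w * r)).totalDegree ≤ m
    omega
  have hinj : Function.Injective (T.restrict hT) := by
    rw [← LinearMap.ker_eq_bot, LinearMap.ker_eq_bot']
    rintro ⟨r, hr⟩ hr0
    have hTr : polyOp ℓ (w * r) = 0 := congrArg Subtype.val hr0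
    have hs : ∀ y ∈ Metric.sphere (0 : EucSp n) 1, ‖y‖ = 1 := fun y hy => by
      simpa using hy
    have h1 := polyFun_le_of_harmonic ℓ hℓ hpos hTr (c := 0) fun y hy => by
      rw [hmul, hs y hy]; simp
    have h2 := polyFun_le_of_harmonic ℓ hℓ hpos (p := w * (-r)) (by
      rw [mul_neg, map_neg, hTr, neg_zero]) (c := 0) fun y hy => by
      rw [hmul, hs y hy]; simp
    apply Subtype.ext
    refine eq_zero_of_polyFun_ball r fun x hx => ?_
    have h3 := h1 x (Metric.ball_subset_closedBall hx)
    have h4 := h2 x (Metric.ball_subset_closedBall hx)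
    rw [hmul] at h3 h4
    have h5 : polyFun (-r) x = - polyFun r x := by simp [polyFun]
    have h6 : 0 < 1 - ‖x‖ ^ 2 := by
      have : ‖x‖ < 1 := by simpa using hx
      nlinarith [norm_nonneg x]
    rw [h5] at h4
    nlinarith
  have hsurj := LinearMap.injective_iff_surjective.1 hinj
  have hLp : -polyOp ℓ p ∈ restrictTotalDegree (Fin n) ℝ m := by
    rw [mem_restrictTotalDegree, totalDegree_neg]
    exact (totalDegree_polyOp_le ℓ p).trans (Nat.sub_le _ _)
  obtain ⟨⟨r, hr⟩, hr'⟩ := hsurj ⟨_, hLp⟩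
  have hr2 : polyOp ℓ (w * r) = -polyOp ℓ p := congrArg Subtype.val hr'
  refine ⟨p + w * r, by rw [map_add, hr2, add_neg_cancel], fun y hy => ?_⟩
  have : polyFun (p + w * r) y = polyFun p y + polyFun (w * r) y := by simp [polyFun]
  rw [this, hmul]
  have : ‖y‖ = 1 := by simpa using hy
  simp [this]

end Polynomials

/-- The unit sphere of Euclidean space. -/
abbrev UnitSph (n : ℕ) := Metric.sphere (0 : EucSp n) 1

section MeanFunctional

open MvPolynomial

/-- Restriction of polynomials to the unit sphere. -/
def polySphere : MvPolynomial (Fin n) ℝ →ₐ[ℝ] C(UnitSph n, ℝ) :=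
  aeval fun i => ⟨fun s => s.1 i, by fun_prop⟩

lemma polySphere_apply (p : MvPolynomial (Fin n) ℝ) (s : UnitSph n) :
    polySphere p s = polyFun p s.1 := by
  induction p using MvPolynomial.induction_on with
  | C a => simp [polySphere, polyFun]
  | add p q hp hq => rw [map_add, polyFun_add, ContinuousMap.add_apply, hp, hq, Pi.add_apply]
  | mul_X p i hp =>
    rw [map_mul, polyFun_mul, ContinuousMap.mul_apply, hp, Pi.mul_apply, polyFun_X]
    simp [polySphere]

lemma exists_poly_near (f : C(UnitSph n, ℝ)) {ε : ℝ} (hε : 0 < ε) :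
    ∃ p : MvPolynomial (Fin n) ℝ, ‖polySphere p - f‖ < ε := by
  have hsep : (polySphere (n := n)).range.SeparatesPoints := by
    intro s t hst
    obtain ⟨i, hi⟩ : ∃ i, s.1 i ≠ t.1 i := by
      by_contra! hcon
      exact hst (Subtype.ext (PiLp.ext hcon))
    refine ⟨_, ⟨polySphere (X i), ⟨X i, rfl⟩, rfl⟩, ?_⟩
    simpa [polySphere_apply, polyFun_X] using hi
  obtain ⟨⟨_, p, rfl⟩, hg⟩ :=
    ContinuousMap.exists_mem_subalgebra_near_continuousMap_of_separatesPoints _ hsep f ε hε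
  exact ⟨p, hg⟩

variable (ℓ : SymMat n →L[ℝ] ℝ)

lemma abs_polyFun_le_norm (hℓ : 0 < ℓ 1) (hpos : IsPosSet {A : SymMat n | 0 ≤ ℓ A})
    {p : MvPolynomial (Fin n) ℝ} (hp : polyOp ℓ p = 0) :
    ∀ y ∈ Metric.closedBall (0 : EucSp n) 1, |polyFun p y| ≤ ‖polySphere p‖ := by
  have hs : ∀ y ∈ Metric.sphere (0 : EucSp n) 1, |polyFun p y| ≤ ‖polySphere p‖ := fun y hy => by
    have := (polySphere p).norm_coe_le_norm ⟨y, hy⟩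
    rwa [polySphere_apply] at this
  intro y hy
  have hneg : ∀ y, polyFun (-p) y = - polyFun p y := fun y => by simp [polyFun]
  rw [abs_le]
  constructor
  · have := polyFun_le_of_harmonic ℓ hℓ hpos (p := -p) (by rw [map_neg, hp, neg_zero])
      (c := ‖polySphere p‖) (fun y hy => by
        rw [hneg]; linarith [(abs_le.1 (hs y hy)).1]) y hy
    rw [hneg] at this
    linarith
  · exact polyFun_le_of_harmonic ℓ hℓ hpos hp (fun y hy => (abs_le.1 (hs y hy)).2) y hy

/-- A bounded functional on `C(Sⁿ⁻¹)` computing the value at the center of polynomial solutions of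
`ℓ(D²q) = 0`. -/
lemma exists_mean_functional (hℓ : 0 < ℓ 1) (hpos : IsPosSet {A : SymMat n | 0 ≤ ℓ A}) :
    ∃ Λ : StrongDual ℝ C(UnitSph n, ℝ), ‖Λ‖ ≤ 1 ∧
      ∀ q, polyOp ℓ q = 0 → Λ (polySphere q) = polyFun q 0 := by
  set H := LinearMap.ker (polyOp ℓ)
  let R : H →ₗ[ℝ] C(UnitSph n, ℝ) := polySphere.toLinearMap ∘ₗ H.subtype
  have hR : Function.Injective R := by
    rw [← LinearMap.ker_eq_bot, LinearMap.ker_eq_bot']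
    rintro ⟨q, hq⟩ hq0
    have hq0' : polySphere q = 0 := hq0
    refine Subtype.ext (eq_zero_of_polyFun_ball q fun x hx => ?_)
    have := abs_polyFun_le_norm ℓ hℓ hpos hq x (Metric.ball_subset_closedBall hx)
    rw [hq0', norm_zero] at this
    exact abs_nonpos_iff.1 this
  let e := LinearEquiv.ofInjective R hR
  let ev : H →ₗ[ℝ] ℝ :=
    { toFun := fun q => polyFun q.1 0
      map_add' := fun p q => by simp [polyFun_add]
      map_smul' := fun c p => by simp [polyFun] }
  let f : StrongDual ℝ (LinearMap.range R) := (ev ∘ₗ e.symm.toLinearMap).mkContinuous 1 (by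
    intro x
    obtain ⟨q, rfl⟩ := e.surjective x
    have h := abs_polyFun_le_norm ℓ hℓ hpos q.2 0 (by simp)
    rw [one_mul]
    change |ev (e.symm (e q))| ≤ ‖R q‖
    rw [e.symm_apply_apply]
    exact h)
  obtain ⟨Λ, hΛ, hnorm⟩ := exists_extension_norm_eq (LinearMap.range R) f
  refine ⟨Λ, hnorm.le.trans (LinearMap.mkContinuous_norm_le _ zero_le_one _), fun q hq => ?_⟩
  have h := hΛ (e ⟨q, hq⟩)
  have h2 : f (e ⟨q, hq⟩) = polyFun q 0 := by
    change ev (e.symm (e ⟨q, hq⟩)) = _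
    rw [e.symm_apply_apply]
    rfl
  rw [h2] at h
  exact h

/-- The values of `u` on the sphere of radius `r` around `z`. -/
def sphereTrace (u : C(EucSp n, ℝ)) (r : ℝ) (z : EucSp n) : C(UnitSph n, ℝ) :=
  ⟨fun s => u (r • s.1 + z), by fun_prop⟩

lemma continuous_sphereTrace (u : C(EucSp n, ℝ)) (r : ℝ) : Continuous (sphereTrace u r) :=
  ContinuousMap.continuous_of_continuous_uncurry _ (by
    simp only [Function.uncurry_def, sphereTrace, ContinuousMap.coe_mk]
    fun_prop)

lemma le_mean_functional (hℓ : 0 < ℓ 1) (hpos : IsPosSet {A : SymMat n | 0 ≤ ℓ A})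
    {Λ : StrongDual ℝ C(UnitSph n, ℝ)} (hΛ1 : ‖Λ‖ ≤ 1)
    (hΛ : ∀ q, polyOp ℓ q = 0 → Λ (polySphere q) = polyFun q 0) (u : C(EucSp n, ℝ)) {r : ℝ}
    (hr : 0 < r) {z : EucSp n} (hu : ∀ y ∈ Metric.closedBall z r, SubAt {A | 0 ≤ ℓ A} u y) :
    u z ≤ Λ (sphereTrace u r z) := by
  refine le_of_forall_pos_le_add fun η hη => ?_
  obtain ⟨p, hp⟩ := exists_poly_near (sphereTrace u r z) (half_pos hη)
  obtain ⟨q, hq, hqp⟩ := exists_harmonic_polynomial ℓ hℓ hpos p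
  have hRq : polySphere q = polySphere p := by
    ext s
    rw [polySphere_apply, polySphere_apply, hqp _ s.2]
  have hle := le_on_ball_of_linear ℓ hℓ (u := fun y => u (r • y + z))
    (q := fun y => polyFun q y + η / 2) (by fun_prop) (fun y hy => ?_)
    ((contDiff_polyFun q).add contDiff_const) (fun y => ?_) (fun y hy => ?_) 0 (by simp)
  · have h1 : |Λ (polySphere q - sphereTrace u r z)| ≤ η / 2 := by
      rw [hRq]
      refine (Λ.le_opNorm _).trans ((mul_le_of_le_one_left (norm_nonneg _) hΛ1).trans hp.le)
    rw [map_sub, hΛ q hq] at h1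
    simp only [smul_zero, zero_add] at hle
    linarith [(abs_le.1 h1).2]
  · refine SubAt.comp_affine hr.ne' (fun A hA => ?_) (hu _ ?_)
    · change 0 ≤ ℓ _
      rw [map_smul]
      exact mul_nonneg (sq_nonneg r) hA
    · have : ‖y‖ ≤ 1 := by simpa using (Metric.ball_subset_closedBall hy)
      rw [mem_closedBall_iff_norm, add_sub_cancel_right, norm_smul, Real.norm_of_nonneg hr.le]
      exact mul_le_of_le_one_right hr.le this
  · rw [hessS_add (contDiff_polyFun q).contDiffAt contDiffAt_const, hessS_const, add_zero,
      ← polyFun_polyOp, hq]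
    simp [polyFun]
  · have h1 := ((polySphere p - sphereTrace u r z).norm_coe_le_norm ⟨y, hy⟩).trans hp.le
    rw [← hRq] at h1
    rw [ContinuousMap.sub_apply, polySphere_apply, Real.norm_eq_abs] at h1
    have h2 : sphereTrace u r z ⟨y, hy⟩ = u (r • y + z) := rfl
    rw [h2] at h1
    linarith [(abs_le.1 h1).1]

lemma symMat_eq_sum (A : SymMat n) :
    A = ∑ i, ∑ j, (A : Matrix (Fin n) (Fin n) ℝ) i j • symUnit i j := by
  have hA : ∀ i j, (A : Matrix (Fin n) (Fin n) ℝ) j i = (A : Matrix (Fin n) (Fin n) ℝ) i j :=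
    fun i j => by
      have := congrFun (congrFun A.2 i) j
      simpa [Matrix.star_apply] using this
  apply Subtype.ext
  ext a b
  simp [symUnit, Matrix.sum_apply, Matrix.single_apply, ite_and, Finset.sum_add_distrib, hA a b]
  ring

/-- The quadratic polynomial of a symmetric matrix. -/
def quadPoly (A : SymMat n) : MvPolynomial (Fin n) ℝ :=
  ∑ i, ∑ j, C ((A : Matrix (Fin n) (Fin n) ℝ) i j) * (X i * X j)

lemma polyFun_quadPoly (A : SymMat n) (x : EucSp n) : polyFun (quadPoly A) x = qf A x := by
  simp [polyFun, quadPoly, qf]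

lemma polyOp_quadPoly (A : SymMat n) : polyOp ℓ (quadPoly A) = C (2 * ℓ A) := by
  have hA : ∀ i j, (A : Matrix (Fin n) (Fin n) ℝ) j i = (A : Matrix (Fin n) (Fin n) ℝ) i j :=
    fun i j => by
      have := congrFun (congrFun A.2 i) j
      simpa [Matrix.star_apply] using this
  have h : ∀ i j, pderiv i (pderiv j (quadPoly A))
      = C (2 * (A : Matrix (Fin n) (Fin n) ℝ) i j) := by
    intro i j
    simp [quadPoly, pderiv_X, Pi.single_apply, Finset.sum_add_distrib, mul_add, hA i j, two_mul]
  have h2 : ℓ A = ∑ i, ∑ j, (A : Matrix (Fin n) (Fin n) ℝ) i j * ℓ (symUnit i j) := by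
    conv_lhs => rw [symMat_eq_sum A]
    simp
  have h3 : polyOp ℓ (quadPoly A)
      = ∑ i, ∑ j, ℓ (symUnit i j) • pderiv i (pderiv j (quadPoly A)) := by
    simp [polyOp]
  simp only [h3, h, h2, Finset.mul_sum, map_sum, smul_eq_C_mul, ← C_mul]
  exact Finset.sum_congr rfl fun i _ => Finset.sum_congr rfl fun j _ => by ring_nf

/-- The polynomial of a linear form. -/
def linPoly (D : EucSp n →L[ℝ] ℝ) : MvPolynomial (Fin n) ℝ :=
  ∑ i, C (D (EuclideanSpace.single i 1)) * X i

lemma polyFun_linPoly (D : EucSp n →L[ℝ] ℝ) (x : EucSp n) : polyFun (linPoly D) x = D x := by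
  have hv : x = ∑ i, x i • EuclideanSpace.single i (1 : ℝ) := by
    ext i
    simp [Finset.sum_apply, Pi.single_apply]
  conv_rhs => rw [hv]
  simp [polyFun, linPoly, mul_comm]

lemma polyOp_linPoly (D : EucSp n →L[ℝ] ℝ) : polyOp ℓ (linPoly D) = 0 := by
  have h : ∀ i j, pderiv i (pderiv j (linPoly D)) = 0 := fun i j => by
    rw [linPoly, map_sum, map_sum]
    refine Finset.sum_eq_zero fun k _ => ?_
    by_cases hk : k = j <;> simp [pderiv_X, hk]
  simp [polyOp, h]

/-- A `C²` function with the sub-mean value property on small spheres has `ℓ(D²v) ≥ 0`. -/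
lemma hessS_nonneg_of_le_mean (hℓ : 0 < ℓ 1)
    {Λ : StrongDual ℝ C(UnitSph n, ℝ)} (hΛ1 : ‖Λ‖ ≤ 1)
    (hΛ : ∀ q, polyOp ℓ q = 0 → Λ (polySphere q) = polyFun q 0) (v : C(EucSp n, ℝ))
    {z : EucSp n} (hv : ContDiffAt ℝ 2 v z)
    (hle : ∀ᶠ r : ℝ in 𝓝[>] 0, v z ≤ Λ (sphereTrace v r z)) : 0 ≤ ℓ (hessS v z) := by
  set A := hessS v z with hA
  set κ := ℓ A / ℓ 1 with hκ
  suffices 0 ≤ κ by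
    have h2 : ℓ A = κ * ℓ 1 := by rw [hκ]; field_simp
    rw [h2]; positivity
  refine le_of_forall_pos_le_add fun ε hε => ?_
  have htay := taylor_two hv (half_pos hε)
  obtain ⟨δ, hδ, hball⟩ := Metric.eventually_nhds_iff_ball.1 htay
  have hsmall : ∀ᶠ r : ℝ in 𝓝[>] 0, r < δ := eventually_nhdsWithin_of_eventually_nhds
    (eventually_lt_nhds hδ)
  obtain ⟨r, ⟨hr, hrδ⟩, hr0⟩ := ((hle.and hsmall).and eventually_mem_nhdsWithin).exists
  have hr0 : 0 < r := hr0
  set Q : MvPolynomial (Fin n) ℝ := C (v z) + r • linPoly (fderiv ℝ v z)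
    + (r ^ 2 / 2) • quadPoly (A - κ • 1) with hQ
  have hQ0 : polyOp ℓ Q = 0 := by
    have hc : polyOp ℓ (C (v z)) = 0 := by simp [polyOp]
    have hz : ℓ (A - κ • 1) = 0 := by
      rw [map_sub, map_smul, smul_eq_mul, hκ]; field_simp; simp
    rw [hQ, map_add, map_add, map_smul, map_smul, polyOp_linPoly, polyOp_quadPoly, hc, hz]
    simp
  have hQf : ∀ s : EucSp n, polyFun Q s = v z + r * fderiv ℝ v z s
      + r ^ 2 / 2 * (qf A s - κ * ‖s‖ ^ 2) := by
    intro s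
    have h1 : qf (A - κ • 1) s = qf A s - κ * ‖s‖ ^ 2 := by
      rw [sub_eq_add_neg, qf_add, qf_neg, qf_smul_mat, qf_one]; ring
    rw [← h1, ← polyFun_linPoly, ← polyFun_quadPoly, hQ]
    simp [polyFun, smul_eval]
  have h1 : polyFun Q 0 = v z := by
    rw [hQf]; simp [qf]
  have h2 := hΛ Q hQ0
  have h3 : Λ 1 = 1 := by
    have := hΛ 1 (by simp [polyOp])
    simp only [map_one] at this
    simpa [polyFun] using this
  have h4 : ‖sphereTrace v r z - polySphere Q - (r ^ 2 / 2 * κ) • (1 : C(UnitSph n, ℝ))‖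
      ≤ ε / 2 * r ^ 2 := by
    rw [ContinuousMap.norm_le _ (by positivity)]
    intro s
    have hs : ‖s.1‖ = 1 := by simp
    have hn : ‖r • s.1‖ = r := by rw [norm_smul, hs, Real.norm_of_nonneg hr0.le, mul_one]
    have h5 := hball (r • s.1 + z) (by
      rw [mem_ball_iff_norm, add_sub_cancel_right, hn]; exact hrδ)
    rw [add_sub_cancel_right, hn, map_smul, qf_smul, smul_eq_mul] at h5
    have h6 : (sphereTrace v r z - polySphere Q - (r ^ 2 / 2 * κ) • (1 : C(UnitSph n, ℝ))) s
        = v (r • s.1 + z) - (v z + r * fderiv ℝ v z s.1 + 1 / 2 * (r ^ 2 * qf A s.1)) := by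
      simp only [ContinuousMap.sub_apply, polySphere_apply, hQf, ContinuousMap.smul_apply,
        ContinuousMap.one_apply, smul_eq_mul, hs, sphereTrace, ContinuousMap.coe_mk]
      ring
    rw [h6]
    exact h5
  have h7 := (Λ.le_opNorm _).trans ((mul_le_of_le_one_left (norm_nonneg _) hΛ1).trans h4)
  rw [map_sub, map_sub, map_smul, h2, h3, h1, smul_eq_mul, mul_one, Real.norm_eq_abs] at h7
  have h8 := (abs_le.1 h7).2
  have h9 : 0 ≤ r ^ 2 * (κ + ε) := by nlinarith
  have := nonneg_of_mul_nonneg_right h9 (by positivity)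
  linarith

end MeanFunctional

/-- A convex cone subequation is an intersection of half-spaces. -/
lemma ConeSubequation.mem_of_forall_functional (F : ConeSubequation n)
    (hconv : Convex ℝ F.carrier) {A : SymMat n}
    (h : ∀ ℓ : SymMat n →L[ℝ] ℝ, 0 < ℓ 1 → (∀ B ∈ F.carrier, 0 ≤ ℓ B) → 0 ≤ ℓ A) :
    A ∈ F.carrier := by
  by_contra hA
  obtain ⟨f, c, hfA, hf⟩ := geometric_hahn_banach_point_closed hconv F.isClosed' hA
  have hc : c < 0 := by simpa using hf 0 F.zero_mem
  have hF : ∀ B ∈ F.carrier, 0 ≤ f B := by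
    intro B hB
    by_contra! hneg
    have h1 := hf _ (F.f2 B hB (c / f B) (div_pos_of_neg_of_neg hc hneg))
    rw [map_smul, smul_eq_mul, div_mul_cancel₀ _ hneg.ne] at h1
    exact lt_irrefl _ h1
  have hlim : Tendsto (fun t : ℝ => t • A) (𝓝[>] 0) (𝓝 0) := by
    have : ContinuousAt (fun t : ℝ => t • A) 0 := by fun_prop
    have h := this.tendsto
    rw [zero_smul] at h
    exact h.mono_left nhdsWithin_le_nhds
  obtain ⟨t, ht, ht0⟩ := ((hlim.eventually
    (posSemidef_smul_one_add_eventually one_pos)).and eventually_mem_nhdsWithin).exists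
  have h1 := hF _ (F.posSemidef_mem ht)
  rw [map_add, map_smul, map_smul, one_smul, smul_eq_mul] at h1
  have ht0 : 0 < t := ht0
  have h2 : t * f A < 0 := mul_neg_of_pos_of_neg ht0 (hfA.trans hc)
  have := h f (by linarith) hF
  linarith

open MeasureTheory in
lemma sphereTrace_convolution {φ : EucSp n → ℝ} (hφ : Continuous φ) (hφs : HasCompactSupport φ)
    (u v : C(EucSp n, ℝ)) (hv : ∀ z, v z = ∫ t, φ t * u (z - t)) (r : ℝ) (z : EucSp n) :
    Integrable (fun t => φ t • sphereTrace u r (z - t)) ∧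
      sphereTrace v r z = ∫ t, φ t • sphereTrace u r (z - t) := by
  have hInt : Integrable (fun t => φ t • sphereTrace u r (z - t)) := by
    refine Continuous.integrable_of_hasCompactSupport ?_ hφs.smul_right
    exact hφ.smul ((continuous_sphereTrace u r).comp (continuous_const.sub continuous_id))
  refine ⟨hInt, ?_⟩
  ext s
  have h := (ContinuousMap.evalCLM ℝ s : C(UnitSph n, ℝ) →L[ℝ] ℝ).integral_comp_comm hInt
  change _ = (ContinuousMap.evalCLM ℝ s : C(UnitSph n, ℝ) →L[ℝ] ℝ) _
  rw [← h]
  change v (r • s.1 + z) = _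
  rw [hv]
  refine integral_congr_ae (Eventually.of_forall fun t => ?_)
  change φ t * u (r • s.1 + z - t) = φ t * u (r • s.1 + (z - t))
  rw [add_sub_assoc]

open MeasureTheory in
/-- Continuous `F`-subharmonic functions for convex `F` are locally uniform limits of smooth
ones. -/
lemma exists_smooth_approx (F : ConeSubequation n) (hconv : Convex ℝ F.carrier)
    {u : EucSp n → ℝ} (huc : Continuous u) (hus : HasCompactSupport u) {X : Set (EucSp n)}
    (hu : ∀ x ∈ X, SubAt F.carrier u x) {δ η : ℝ} (hδ : 0 < δ) (hη : 0 < η) :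
    ∃ v : EucSp n → ℝ, ContDiff ℝ 2 v ∧ (∀ y, |v y - u y| ≤ η) ∧
      ∀ z, Metric.closedBall z δ ⊆ X → hessS v z ∈ F.carrier := by
  have hunif := hus.uniformContinuous_of_continuous huc
  obtain ⟨ε', hε', hε⟩ := Metric.uniformContinuous_iff.1 hunif η hη
  set ε := min ε' (δ / 2) with hεdef
  have hε0 : 0 < ε := lt_min hε' (half_pos hδ)
  let φ : ContDiffBump (0 : EucSp n) := ⟨ε / 2, ε, half_pos hε0, half_lt_self hε0⟩
  set ψ := φ.normed volume with hψ
  set v : EucSp n → ℝ := convolution ψ u (ContinuousLinearMap.lsmul ℝ ℝ) volume with hvdef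
  have hvz : ∀ z, v z = ∫ t, ψ t * u (z - t) := fun z => rfl
  have hvC : ContDiff ℝ 2 v := by
    have := φ.hasCompactSupport_normed (μ := volume)
    exact HasCompactSupport.contDiff_convolution_left (n := 2) _ this φ.contDiff_normed
      huc.locallyIntegrable
  refine ⟨v, hvC, fun y => ?_, fun z hz => ?_⟩
  · rw [← Real.dist_eq]
    exact φ.dist_normed_convolution_le huc.aestronglyMeasurable fun x hx =>
      (hε (lt_of_lt_of_le hx (min_le_left _ _))).le
  · refine F.mem_of_forall_functional hconv fun ℓ hℓ hℓF => ?_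
    have hpos : IsPosSet {A : SymMat n | 0 ≤ ℓ A} := fun A hA P hP => by
      change 0 ≤ ℓ _
      rw [map_add]
      exact add_nonneg hA (hℓF _ (F.posSemidef_mem hP))
    obtain ⟨Λ, hΛ1, hΛ⟩ := exists_mean_functional ℓ hℓ hpos
    refine hessS_nonneg_of_le_mean ℓ hℓ hΛ1 hΛ ⟨v, hvC.continuous⟩ hvC.contDiffAt ?_
    have hsmall : ∀ᶠ r : ℝ in 𝓝[>] 0, r < δ / 2 := eventually_nhdsWithin_of_eventually_nhds
      (eventually_lt_nhds (half_pos hδ))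
    filter_upwards [hsmall, eventually_mem_nhdsWithin] with r hr hr0
    obtain ⟨hInt, htr⟩ := sphereTrace_convolution φ.continuous_normed φ.hasCompactSupport_normed
      ⟨u, huc⟩ ⟨v, hvC.continuous⟩ hvz r z
    rw [htr, ← Λ.integral_comp_comm hInt]
    change v z ≤ _
    rw [hvz]
    refine integral_mono ?_ (Λ.integrable_comp hInt) fun t => ?_
    · exact Continuous.integrable_of_hasCompactSupport
        (φ.continuous_normed.mul (huc.comp (continuous_const.sub continuous_id)))
        φ.hasCompactSupport_normed.mul_right
    · simp only [map_smul, smul_eq_mul]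
      by_cases ht : t ∈ Metric.ball (0 : EucSp n) ε
      · refine mul_le_mul_of_nonneg_left ?_ (φ.nonneg_normed t)
        refine le_mean_functional ℓ hℓ hpos hΛ1 hΛ ⟨u, huc⟩ hr0 fun y hy => ?_
        refine (hu y (hz ?_)).mono_set hℓF
        rw [mem_closedBall_iff_norm] at hy ⊢
        have h1 : ‖t‖ < δ / 2 := (mem_ball_zero_iff.1 ht).trans_le (min_le_right _ _)
        have h2 : y - z = (y - (z - t)) - t := by abel
        rw [h2]
        exact (norm_sub_le _ _).trans (by linarith)
      · have : φ.normed volume t = 0 := by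
          rw [← Function.notMem_support, φ.support_normed_eq]
          exact ht
        have h0 : ψ t = 0 := this
        simp [this, h0]

/-- Comparison principle. -/
lemma comparison (F : ConeSubequation n) (hconv : Convex ℝ F.carrier) {K X : Set (EucSp n)}
    (hK : IsCompact K) (hX : IsOpen X) (hXK : X ⊆ K) {u w : EucSp n → ℝ} (huc : Continuous u)
    (hus : HasCompactSupport u) (hwc : ContinuousOn w K)
    (hu : ∀ x ∈ X, SubAt F.carrier u x)
    (hw : ∀ x ∈ X, SubAt (dualSet F.carrier) (fun y => - w y) x)
    (hle : ∀ x ∈ K, x ∉ X → u x ≤ w x) : ∀ x ∈ K, u x ≤ w x := by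
  intro y₀ hy₀
  by_contra! hcon
  set m := u y₀ - w y₀ with hm
  have hm0 : 0 < m := sub_pos.2 hcon
  have hgc : ContinuousOn (fun y => u y - w y) K := huc.continuousOn.sub hwc
  set K' := K ∩ (fun y => u y - w y) ⁻¹' Set.Ici (m / 2) with hK'
  have hK'c : IsCompact K' := by
    obtain ⟨Z, hZ, hZK⟩ := continuousOn_iff_isClosed.1 hgc _ (isClosed_Ici (a := m / 2))
    rw [hK', Set.inter_comm, hZK, Set.inter_comm]
    exact hK.inter_right hZ
  have hK'X : K' ⊆ X := by
    rintro y ⟨hyK, hy⟩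
    by_contra hyX
    have h1 := hle y hyK hyX
    have h2 : m / 2 ≤ u y - w y := hy
    linarith
  obtain ⟨δ, hδ, hδX⟩ := hK'c.exists_cthickening_subset_open hX hK'X
  obtain ⟨v, hvC, hvu, hv⟩ := exists_smooth_approx F hconv huc hus hu hδ (η := m / 16)
    (by positivity)
  obtain ⟨R, hR⟩ := hK.isBounded.exists_norm_le
  have hR0 : 0 ≤ R := (norm_nonneg _).trans (hR y₀ hy₀)
  set η := m / 16 / (R ^ 2 + 1) with hη
  have hη0 : 0 < η := by positivity
  have hηR : ∀ y ∈ K, η * ‖y - 0‖ ^ 2 ≤ m / 16 := by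
    intro y hy
    rw [sub_zero]
    have h1 : ‖y‖ ^ 2 ≤ R ^ 2 + 1 := by nlinarith [hR y hy, norm_nonneg y]
    calc η * ‖y‖ ^ 2 ≤ η * (R ^ 2 + 1) := by gcongr
      _ = m / 16 := by rw [hη]; field_simp
  obtain ⟨y, hyK, hymax⟩ := hK.exists_isMaxOn ⟨y₀, hy₀⟩ 
    (f := fun y => - w y - (-(v y + η * ‖y - 0‖ ^ 2)))
    (hwc.neg.sub (by have := hvC.continuous; fun_prop))
  have hyK' : y ∈ K' := by
    refine ⟨hyK, ?_⟩
    have h1 : - w y₀ - (-(v y₀ + η * ‖y₀ - 0‖ ^ 2)) ≤ - w y - (-(v y + η * ‖y - 0‖ ^ 2)) :=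
      hymax hy₀
    have h2 := abs_le.1 (hvu y)
    have h3 := abs_le.1 (hvu y₀)
    have h4 := hηR y hyK
    have h5 : 0 ≤ η * ‖y₀ - 0‖ ^ 2 := by positivity
    change m / 2 ≤ u y - w y
    linarith
  have hyX := hK'X hyK'
  have hloc := (hymax.on_subset hXK).isLocalMax (hX.mem_nhds hyX)
  have hsq : ContDiffAt ℝ 2 (fun y : EucSp n => ‖y - 0‖ ^ 2) y :=
    ((contDiff_id.sub contDiff_const).norm_sq ℝ).contDiffAt
  have hf := hvC.contDiffAt.add ((contDiffAt_const (c := η)).mul hsq)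
  have h := (hw y hyX).hessS_mem_of_isLocalMax hf.neg hloc
  rw [hessS_neg hf, hessS_add hvC.contDiffAt (contDiffAt_const.mul hsq), hessS_smul _ hsq,
    hessS_normSq, smul_smul] at h
  apply h
  rw [neg_neg]
  refine F.add_smul_one_mem_interior (hv y ?_) (by positivity)
  exact (Metric.closedBall_subset_cthickening hyK' δ).trans hδX

lemma qf_eq_dotProduct (A : SymMat n) (v : EucSp n) :
    qf A v = v.ofLp ⬝ᵥ (A : Matrix (Fin n) (Fin n) ℝ).mulVec v.ofLp := by
  simp only [dotProduct, Matrix.mulVec, qf, Finset.mul_sum]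
  exact Finset.sum_congr rfl fun i _ => Finset.sum_congr rfl fun j _ => by ring

lemma projMat_mulVec (e v : EucSp n) :
    (projMat e).mulVec v.ofLp = (inner ℝ e v • e).ofLp := by
  ext i
  simp only [Matrix.mulVec, dotProduct, projMat, Matrix.of_apply, PiLp.smul_apply, smul_eq_mul,
    PiLp.inner_apply, RCLike.inner_apply, conj_trivial, Finset.sum_mul]
  exact Finset.sum_congr rfl fun j _ => by ring

lemma qf_symProj (e v : EucSp n) : qf (symProj e) v = inner ℝ e v ^ 2 := by
  rw [qf_eq_dotProduct, symProj, projMat_mulVec]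
  simp only [dotProduct, PiLp.smul_apply, smul_eq_mul,
    PiLp.inner_apply, RCLike.inner_apply, conj_trivial, sq, Finset.sum_mul, Finset.mul_sum]
  exact Finset.sum_congr rfl fun j _ => Finset.sum_congr rfl fun j _ => by ring

lemma qf_secondFF {ρ : EucSp n → ℝ} {x : EucSp n} (hρ : ContDiffAt ℝ 2 ρ x) {S : SymMat n} {t : ℝ}
    (hS : (S : Matrix (Fin n) (Fin n) ℝ) = secondFF ρ x + t • projMat (innerNormal ρ x))
    (v : EucSp n) :
    qf S v = ‖gradient ρ x‖⁻¹ *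
      qf (hessS ρ x) (v - inner ℝ (innerNormal ρ x) v • innerNormal ρ x)
      + t * inner ℝ (innerNormal ρ x) v ^ 2 := by
  set ν := innerNormal ρ x
  have h1 : (1 - projMat ν).mulVec v.ofLp = (v - inner ℝ ν v • ν).ofLp := by
    rw [Matrix.sub_mulVec, Matrix.one_mulVec, projMat_mulVec]
    rfl
  have h2 : (1 - projMat ν).transpose = 1 - projMat ν := by
    ext i j
    simp [projMat, Matrix.one_apply, eq_comm, mul_comm]
  rw [← qf_symProj, qf_eq_dotProduct, qf_eq_dotProduct, qf_eq_dotProduct, hS, secondFF,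
    hessS_coe hρ, Matrix.add_mulVec, Matrix.smul_mulVec, Matrix.smul_mulVec, dotProduct_add,
    dotProduct_smul, dotProduct_smul, ← Matrix.mulVec_mulVec, ← Matrix.mulVec_mulVec, h1, ← h1,
    Matrix.dotProduct_mulVec, ← Matrix.mulVec_transpose, h2, smul_eq_mul, smul_eq_mul]
  rfl

/-- Strict convexity of the boundary in terms of the Hessian of the defining function. -/
lemma hessS_add_normal_mem_interior (F : ConeSubequation n) {ρ : EucSp n → ℝ} {x : EucSp n}
    (hρ : ContDiffAt ℝ 2 ρ x) (hN : gradient ρ x ≠ 0) {t : ℝ}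
    (ht : secondFF ρ x + t • projMat (innerNormal ρ x) ∈ Subtype.val '' interior F.carrier) :
    ∃ l₀ : ℝ, ∀ l ≥ l₀,
      hessS ρ x + (l * ‖gradient ρ x‖ ^ 2) • symProj (innerNormal ρ x) ∈ interior F.carrier := by
  obtain ⟨S, hSF, hS⟩ := ht
  set ν := innerNormal ρ x with hν
  set N := ‖gradient ρ x‖
  have hN0 : 0 < N := norm_pos_iff.2 hN
  have hνn : ‖ν‖ = 1 := by
    rw [hν, innerNormal, norm_neg, norm_smul, norm_inv, norm_norm, inv_mul_cancel₀ hN0.ne']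
  have hNS := F.smul_mem_interior hSF hN0
  obtain ⟨ε, hεF, hε⟩ : ∃ ε : ℝ, N • S - ε • 1 ∈ interior F.carrier ∧ 0 < ε := by
    have hlim : Tendsto (fun ε : ℝ => N • S - ε • (1 : SymMat n)) (𝓝[>] 0) (𝓝 (N • S)) := by
      have : ContinuousAt (fun ε : ℝ => N • S - ε • (1 : SymMat n)) 0 := by fun_prop
      have h := this.tendsto
      rw [zero_smul, sub_zero] at h
      exact h.mono_left nhdsWithin_le_nhds
    exact ((hlim.eventually_mem (isOpen_interior.mem_nhds hNS)).and
      eventually_mem_nhdsWithin).exists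
  set B := fderiv ℝ (fderiv ℝ ρ) x
  set b := ‖B‖
  have hb0 : 0 ≤ b := norm_nonneg B
  refine ⟨(N * t + b + b ^ 2 / ε) / N ^ 2, fun l hl => ?_⟩
  have hl' : N * t + b + b ^ 2 / ε ≤ l * N ^ 2 := (div_le_iff₀ (by positivity)).1 hl
  have hD : ((hessS ρ x + (l * N ^ 2) • symProj ν - (N • S - ε • 1) : SymMat n) :
      Matrix (Fin n) (Fin n) ℝ).PosSemidef := by
    rw [posSemidef_iff_qf]
    intro v
    set a := inner ℝ ν v with ha
    set w := v - a • ν with hw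
    have hv : v = w + a • ν := by rw [hw]; abel
    have hwν : inner ℝ w (a • ν) = 0 := by
      rw [inner_smul_right, hw, inner_sub_left, real_inner_smul_left, real_inner_self_eq_norm_sq,
        hνn, real_inner_comm, ← ha]
      ring
    have hnorm : ‖v‖ ^ 2 = ‖w‖ ^ 2 + a ^ 2 := by
      have := norm_add_sq_eq_norm_sq_add_norm_sq_real hwν
      rw [← hv, norm_smul, hνn, mul_one, Real.norm_eq_abs, abs_mul_abs_self] at this
      nlinarith
    have hBv : B v v = B w w + a * (B w ν + B ν w) + a ^ 2 * B ν ν := by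
      conv_lhs => rw [hv]
      simp only [map_add, map_smul, _root_.add_apply, _root_.smul_apply, smul_eq_mul]
      ring
    have hq : qf (hessS ρ x + (l * N ^ 2) • symProj ν - (N • S - ε • 1)) v
        = a * (B w ν + B ν w) + a ^ 2 * B ν ν + (l * N ^ 2 - N * t) * a ^ 2
          + ε * (‖w‖ ^ 2 + a ^ 2) := by
      rw [sub_eq_add_neg, sub_eq_add_neg, qf_add, qf_add, qf_neg, qf_add, qf_neg, qf_smul_mat,
        qf_smul_mat, qf_smul_mat, qf_one, qf_symProj, qf_secondFF hρ hS, qf_hessS hρ, qf_hessS hρ,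
        ← hnorm, ← hν, ← ha, ← hw]
      change B v v + _ + -(N * (N⁻¹ * B w w + _) + _) = _
      have hcancel : N * (N⁻¹ * B w w) = B w w := mul_inv_cancel_left₀ hN0.ne' _
      rw [hBv]
      linear_combination -hcancel
    rw [hq]
    have h1 : |B w ν| ≤ b * ‖w‖ := by simpa [hνn] using B.le_opNorm₂ w ν
    have h2 : |B ν w| ≤ b * ‖w‖ := by simpa [hνn] using B.le_opNorm₂ ν w
    have h3 : |B ν ν| ≤ b := by simpa [hνn] using B.le_opNorm₂ ν ν
    have h4 : -(2 * (b * ‖w‖ * |a|)) ≤ a * (B w ν + B ν w) := by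
      have : |a * (B w ν + B ν w)| ≤ |a| * (b * ‖w‖ + b * ‖w‖) := by
        rw [abs_mul]
        exact mul_le_mul_of_nonneg_left ((abs_add_le _ _).trans (add_le_add h1 h2)) (abs_nonneg _)
      linarith [(abs_le.1 this).1]
    have h5 : 0 ≤ a ^ 2 * (B ν ν + b) := mul_nonneg (sq_nonneg a) (by linarith [(abs_le.1 h3).1])
    have h6 : (b + b ^ 2 / ε) * a ^ 2 ≤ (l * N ^ 2 - N * t) * a ^ 2 :=
      mul_le_mul_of_nonneg_right (by linarith) (sq_nonneg a)
    have h7 : 0 ≤ (ε * ‖w‖ - b * |a|) ^ 2 / ε := by positivity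
    have h8 : (ε * ‖w‖ - b * |a|) ^ 2 / ε
        = ε * ‖w‖ ^ 2 - 2 * (b * ‖w‖ * |a|) + b ^ 2 / ε * a ^ 2 := by
      rw [← sq_abs a]; field_simp; ring
    have h9 : 0 ≤ ε * a ^ 2 := by positivity
    nlinarith
  have := F.interior_add hεF hD
  rwa [add_sub_cancel] at this

lemma hessS_exp {ρ : EucSp n → ℝ} (hρ : ContDiff ℝ 2 ρ) (l : ℝ) (x : EucSp n) :
    hessS (fun y => Real.exp (l * ρ y)) x = (l * Real.exp (l * ρ x)) •
      (hessS ρ x + (l * ‖gradient ρ x‖ ^ 2) • symProj (innerNormal ρ x)) := by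
  have hd : ∀ y, HasFDerivAt ρ (fderiv ℝ ρ y) y := fun y =>
    (hρ.differentiable (by simp) y).hasFDerivAt
  have hexp : ∀ y, HasFDerivAt (fun y => Real.exp (l * ρ y))
      (Real.exp (l * ρ y) • l • fderiv ℝ ρ y) y := fun y => ((hd y).const_mul l).exp
  have h1 : fderiv ℝ (fun y => Real.exp (l * ρ y)) =
      fun y => Real.exp (l * ρ y) • l • fderiv ℝ ρ y := funext fun y => (hexp y).fderiv
  have hd2 : HasFDerivAt (fderiv ℝ ρ) (fderiv ℝ (fderiv ℝ ρ) x) x :=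
    ((hρ.fderiv_right (m := 1) (by norm_num)).differentiable (by simp) x).hasFDerivAt
  have h2 := (hexp x).smul (hd2.const_smul l)
  have hgrad : ∀ i, fderiv ℝ ρ x (EuclideanSpace.single i 1) = gradient ρ x i := by
    intro i
    rw [gradient]
    have := InnerProductSpace.toDual_symm_apply (𝕜 := ℝ) (x := EuclideanSpace.single i (1 : ℝ))
      (y := fderiv ℝ ρ x)
    rw [EuclideanSpace.inner_single_right] at this
    simpa using this.symm
  have hC : ContDiffAt ℝ 2 (fun y => Real.exp (l * ρ y)) x :=
    (Real.contDiff_exp.comp (contDiff_const.mul hρ)).contDiffAt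
  apply symMat_ext
  intro i j
  rw [hessS_coe hC, hessMatrix_apply, h1]
  have h3 : fderiv ℝ (fun y => Real.exp (l * ρ y) • l • fderiv ℝ ρ y) x = _ := h2.fderiv
  rw [h3]
  have hproj : ‖gradient ρ x‖ ^ 2 * projMat (innerNormal ρ x) i j
      = gradient ρ x i * gradient ρ x j := by
    by_cases h0 : gradient ρ x = 0
    · simp [h0]
    · have : ‖gradient ρ x‖ ≠ 0 := norm_ne_zero_iff.2 h0
      simp [projMat, innerNormal]
      field_simp
  change _ = (l * Real.exp (l * ρ x)) * ((hessS ρ x : Matrix (Fin n) (Fin n) ℝ) i j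
    + (l * ‖gradient ρ x‖ ^ 2) * projMat (innerNormal ρ x) i j)
  rw [mul_assoc l (‖gradient ρ x‖ ^ 2), hproj, hessS_coe hρ.contDiffAt, hessMatrix_apply, ← hgrad,
    ← hgrad]
  simp
  ring

/-- Boundary barriers on strictly convex domains. -/
lemma exists_barrier (F : ConeSubequation n) {Ω : Set (EucSp n)} (hb : Bornology.IsBounded Ω)
    (hbdry : StrictlyConvexBoundary F Ω) {x₀ : EucSp n} (hx₀ : x₀ ∈ Ω) :
    ∃ g : EucSp n → ℝ, Continuous g ∧ (∀ y ∈ frontier Ω, g y = 0) ∧ (∀ y ∈ Ω, g y < 0) ∧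
      g x₀ ≤ -1 ∧ ∀ y ∈ Ω, g y ≤ -1 ∨ SubAt F.carrier g y := by
  obtain ⟨ρ, hρ', hΩρ, hρF⟩ := hbdry
  have hρ : ContDiff ℝ 2 ρ := contDiff_infty.1 hρ' 2
  have hfr0 : ∀ y ∈ frontier Ω, ρ y = 0 := fun y hy => by
    rw [hΩρ] at hy
    exact frontier_lt_subset_eq hρ.continuous continuous_const hy
  have hfrc : IsCompact (frontier Ω) :=
    hb.isCompact_closure.of_isClosed_subset isClosed_frontier frontier_subset_closure
  have hE : ∀ l : ℝ, ContDiff ℝ 2 (fun y => Real.exp (l * ρ y)) := fun l =>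
    Real.contDiff_exp.comp (contDiff_const.mul hρ)
  obtain ⟨l₀, hl₀⟩ : ∃ l₀ : ℝ, ∀ y ∈ frontier Ω, ∀ l ≥ l₀,
      hessS ρ y + (l * ‖gradient ρ y‖ ^ 2) • symProj (innerNormal ρ y) ∈ interior F.carrier := by
    refine hfrc.induction_on (p := fun s => ∃ l₀ : ℝ, ∀ y ∈ s, ∀ l ≥ l₀,
      hessS ρ y + (l * ‖gradient ρ y‖ ^ 2) • symProj (innerNormal ρ y) ∈ interior F.carrier)
      ⟨0, by simp⟩ ?_ ?_ ?_
    · rintro s t hst ⟨l, hl⟩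
      exact ⟨l, fun y hy => hl y (hst hy)⟩
    · rintro s t ⟨l, hl⟩ ⟨l', hl'⟩
      refine ⟨max l l', fun y hy k hk => ?_⟩
      rcases hy with hy | hy
      · exact hl y hy k ((le_max_left _ _).trans hk)
      · exact hl' y hy k ((le_max_right _ _).trans hk)
    · intro x hx
      obtain ⟨hN, t, ht⟩ := hρF x hx
      obtain ⟨l, hl⟩ := hessS_add_normal_mem_interior F hρ.contDiffAt hN (ht t le_rfl)
      set k := max l 1
      have hk : 0 < k := lt_max_of_lt_right one_pos
      have hkx : hessS (fun y => Real.exp (k * ρ y)) x ∈ interior F.carrier := by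
        rw [hessS_exp hρ]
        exact F.smul_mem_interior (hl k (le_max_left _ _)) (by positivity)
      have hnear := (hessS_continuousAt (hE k).contDiffAt).eventually_mem
        (isOpen_interior.mem_nhds hkx)
      refine ⟨_, mem_nhdsWithin_of_mem_nhds hnear, k, fun y hy k' hk' => ?_⟩
      have hy : hessS (fun y => Real.exp (k * ρ y)) y ∈ interior F.carrier := hy
      rw [hessS_exp hρ] at hy
      have h1 := F.smul_mem_interior hy (t := (k * Real.exp (k * ρ y))⁻¹) (by positivity)
      rw [smul_smul, inv_mul_cancel₀ (by positivity), one_smul] at h1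
      have h2 : (((k' - k) * ‖gradient ρ y‖ ^ 2) • symProj (innerNormal ρ y) :
          SymMat n).1.PosSemidef := by
        rw [posSemidef_iff_qf]
        intro v
        rw [qf_smul_mat, qf_symProj]
        have : 0 ≤ k' - k := sub_nonneg.2 hk'
        positivity
      have h3 := F.interior_add h1 h2
      rw [add_assoc, ← add_smul] at h3
      convert h3 using 3
      ring
  set l := max l₀ 1
  have hl : 0 < l := lt_max_of_lt_right one_pos
  set e : EucSp n → ℝ := fun y => Real.exp (l * ρ y) with he
  have heC : ContDiff ℝ 2 e := hE l
  set V : Set (EucSp n) := {y | hessS e y ∈ interior F.carrier} with hV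
  have hVo : IsOpen V := by
    rw [isOpen_iff_mem_nhds]
    intro y hy
    exact (hessS_continuousAt heC.contDiffAt).eventually_mem (isOpen_interior.mem_nhds hy)
  have hfrV : frontier Ω ⊆ V := fun y hy => by
    change hessS e y ∈ interior F.carrier
    rw [he, hessS_exp hρ]
    exact F.smul_mem_interior (hl₀ y hy l (le_max_left _ _)) (by positivity)
  have heneg : ∀ y ∈ Ω, e y - 1 < 0 := fun y hy => by
    rw [hΩρ] at hy
    have : ρ y < 0 := hy
    rw [sub_neg, he, Real.exp_lt_one_iff]
    exact mul_neg_of_pos_of_neg hl this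
  have hΩo : IsOpen Ω := by
    rw [hΩρ]; exact isOpen_lt hρ.continuous continuous_const
  have hΩc : closure Ω ⊆ Ω ∪ frontier Ω := by
    rw [closure_eq_self_union_frontier]
  set K : Set (EucSp n) := insert x₀ (closure Ω \ V) with hK
  have hKc : IsCompact K := (hb.isCompact_closure.diff hVo).insert x₀
  have hKΩ : K ⊆ Ω := by
    rintro y (rfl | ⟨hy, hyV⟩)
    · exact hx₀
    · rcases hΩc hy with h | h
      · exact h
      · exact absurd (hfrV h) hyV
  obtain ⟨y₁, hy₁, hmax⟩ := hKc.exists_isMaxOn ⟨x₀, Set.mem_insert _ _⟩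
    (f := fun y => e y - 1) (heC.continuous.sub continuous_const).continuousOn
  have hneg := heneg y₁ (hKΩ hy₁)
  set c := (-(e y₁ - 1))⁻¹ with hc
  have hc0 : 0 < c := inv_pos.2 (neg_pos.2 hneg)
  have hcK : ∀ y ∈ K, c * (e y - 1) ≤ -1 := fun y hy => by
    have h1 : e y - 1 ≤ e y₁ - 1 := hmax hy
    have h2 : c * (-(e y₁ - 1)) = 1 := inv_mul_cancel₀ (neg_pos.2 hneg).ne'
    nlinarith
  refine ⟨fun y => c * (e y - 1), continuous_const.mul (heC.continuous.sub continuous_const),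
    fun y hy => by simp [he, hfr0 y hy], fun y hy => mul_neg_of_pos_of_neg hc0 (heneg y hy),
    hcK _ (Set.mem_insert _ _), fun y hy => ?_⟩
  by_cases hyV : y ∈ V
  · right
    have h1 : SubAt F.carrier e y :=
      subAt_of_hessS_mem F.isPosSet heC.contDiffAt (interior_subset hyV)
    exact (h1.add_const (-1)).const_mul F.f2 hc0
  · exact Or.inl (hcK y (Or.inr ⟨subset_closure hy, hyV⟩))

/-- The Perron family for the Dirichlet problem on `Ω` with an interior point `x₀` at which the
value is prescribed. -/
def perronFamily (F : ConeSubequation n) (Ω : Set (EucSp n)) (x₀ : EucSp n)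
    (u₀ : EucSp n → ℝ) : Set (EucSp n → ℝ) :=
  {u | Continuous u ∧ (∀ x ∈ Ω \ {x₀}, SubAt F.carrier u x) ∧ (∀ y, u₀ y ≤ u y) ∧
    (∀ y, y ∉ Ω → u y ≤ 0) ∧ u x₀ ≤ -1}

/-- The upper envelope of the Perron family. -/
def perronEnvelope (F : ConeSubequation n) (Ω : Set (EucSp n)) (x₀ : EucSp n)
    (u₀ : EucSp n → ℝ) (y : EucSp n) : ℝ :=
  ⨆ u : perronFamily F Ω x₀ u₀, u.1 y

/-- Lower and upper barriers for the Perron method. -/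
structure PerronData (F : ConeSubequation n) (Ω : Set (EucSp n)) (x₀ : EucSp n)
    (u₀ w : EucSp n → ℝ) : Prop where
  convex : Convex ℝ F.carrier
  isOpen : IsOpen Ω
  isBounded : Bornology.IsBounded Ω
  mem : x₀ ∈ Ω
  lower_continuous : Continuous u₀
  lower_sub : ∀ x ∈ Ω \ {x₀}, SubAt F.carrier u₀ x
  lower_eq : ∀ y, y ∉ Ω → u₀ y = 0
  lower_center : u₀ x₀ = -1
  lower_bound : ∀ y, -1 ≤ u₀ y
  upper_continuous : ContinuousOn w (closure Ω)
  upper_super : ∀ x ∈ Ω \ {x₀}, SubAt (dualSet F.carrier) (fun y => -w y) x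
  upper_nonneg : ∀ y ∈ frontier Ω, 0 ≤ w y
  upper_center : w x₀ = -1

/-- Comparison on a punctured domain, for a subsolution vanishing outside the domain. -/
lemma comparison_punctured (F : ConeSubequation n) (hconv : Convex ℝ F.carrier)
    {Ω : Set (EucSp n)} (hΩ : IsOpen Ω) (hb : Bornology.IsBounded Ω) {x₀ : EucSp n}
    {u w : EucSp n → ℝ} (huc : Continuous u) (hu0 : ∀ y, y ∉ Ω → u y = 0)
    (hu : ∀ x ∈ Ω \ {x₀}, SubAt F.carrier u x) (hwc : ContinuousOn w (closure Ω))
    (hw : ∀ x ∈ Ω \ {x₀}, SubAt (dualSet F.carrier) (fun y => -w y) x)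
    (hfr : ∀ y ∈ frontier Ω, 0 ≤ w y) (hx₀ : u x₀ ≤ w x₀) : ∀ y ∈ closure Ω, u y ≤ w y := by
  have hK := hb.isCompact_closure
  refine comparison F hconv hK (hΩ.sdiff isClosed_singleton)
    (Set.sdiff_subset.trans subset_closure) huc
    (HasCompactSupport.intro hK fun y hy => hu0 y fun h => hy (subset_closure h)) hwc hu hw ?_
  intro y hy hyX
  by_cases hyΩ : y ∈ Ω
  · have : y = x₀ := by
      by_contra hne
      exact hyX ⟨hyΩ, hne⟩
    rwa [this]
  · rw [hu0 y hyΩ]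
    exact hfr y (by rw [hΩ.frontier_eq]; exact ⟨hy, hyΩ⟩)

namespace PerronData

variable {F : ConeSubequation n} {Ω : Set (EucSp n)} {x₀ : EucSp n} {u₀ w : EucSp n → ℝ}

lemma lower_mem (D : PerronData F Ω x₀ u₀ w) : u₀ ∈ perronFamily F Ω x₀ u₀ :=
  ⟨D.lower_continuous, D.lower_sub, fun _ => le_rfl, fun y hy => (D.lower_eq y hy).le,
    D.lower_center.le⟩

lemma eq_zero (D : PerronData F Ω x₀ u₀ w) {u : EucSp n → ℝ} (hu : u ∈ perronFamily F Ω x₀ u₀)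
    {y : EucSp n} (hy : y ∉ Ω) : u y = 0 :=
  le_antisymm (hu.2.2.2.1 y hy) ((D.lower_eq y hy).symm.le.trans (hu.2.2.1 y))

lemma le_upper (D : PerronData F Ω x₀ u₀ w) {u : EucSp n → ℝ} (hu : u ∈ perronFamily F Ω x₀ u₀) :
    ∀ y ∈ closure Ω, u y ≤ w y :=
  comparison_punctured F D.convex D.isOpen D.isBounded hu.1 (fun _ hy => D.eq_zero hu hy) hu.2.1
    D.upper_continuous D.upper_super D.upper_nonneg (hu.2.2.2.2.trans D.upper_center.symm.le)

lemma nonpos (D : PerronData F Ω x₀ u₀ w) {u : EucSp n → ℝ} (hu : u ∈ perronFamily F Ω x₀ u₀)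
    (y : EucSp n) : u y ≤ 0 := by
  by_cases hy : y ∈ Ω
  · refine comparison_punctured F D.convex D.isOpen D.isBounded hu.1
      (fun _ hy => D.eq_zero hu hy) hu.2.1 (w := fun _ => 0) continuousOn_const ?_
      (fun _ _ => le_rfl) (hu.2.2.2.2.trans (by norm_num)) y (subset_closure hy)
    intro x _
    simpa using F.subAt_dualSet_const 0 x
  · exact (D.eq_zero hu hy).le

lemma bddAbove (D : PerronData F Ω x₀ u₀ w) (y : EucSp n) :
    BddAbove (Set.range fun u : perronFamily F Ω x₀ u₀ => u.1 y) :=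
  ⟨0, by rintro _ ⟨u, rfl⟩; exact D.nonpos u.2 y⟩

lemma le_envelope (D : PerronData F Ω x₀ u₀ w) {u : EucSp n → ℝ}
    (hu : u ∈ perronFamily F Ω x₀ u₀) (y : EucSp n) : u y ≤ perronEnvelope F Ω x₀ u₀ y :=
  le_ciSup (D.bddAbove y) (⟨u, hu⟩ : perronFamily F Ω x₀ u₀)

lemma envelope_le (D : PerronData F Ω x₀ u₀ w) {y : EucSp n} {c : ℝ}
    (h : ∀ u ∈ perronFamily F Ω x₀ u₀, u y ≤ c) : perronEnvelope F Ω x₀ u₀ y ≤ c :=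
  have : Nonempty (perronFamily F Ω x₀ u₀) := ⟨⟨u₀, D.lower_mem⟩⟩
  ciSup_le fun u => h u.1 u.2

lemma max_translate_mem (D : PerronData F Ω x₀ u₀ w) {ε : ℝ} (hε : 0 < ε) :
    ∃ δ : ℝ, 0 < δ ∧ ∀ z : EucSp n, ‖z‖ < δ → ∀ u ∈ perronFamily F Ω x₀ u₀,
      (fun y => max (u y) (u (y + z) - ε)) ∈ perronFamily F Ω x₀ u₀ := by
  have hunif : UniformContinuous u₀ :=
    HasCompactSupport.uniformContinuous_of_continuous
      (HasCompactSupport.intro D.isBounded.isCompact_closure fun y hy =>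
        D.lower_eq y fun h => hy (subset_closure h)) D.lower_continuous
  obtain ⟨δ₁, hδ₁, h₁⟩ := Metric.uniformContinuous_iff.1 hunif ε hε
  have hwat : ContinuousAt w x₀ :=
    D.upper_continuous.continuousAt (mem_of_superset (D.isOpen.mem_nhds D.mem) subset_closure)
  obtain ⟨δ₂, hδ₂, h₂⟩ := Metric.eventually_nhds_iff.1
    ((hwat.eventually_lt_const (by rw [D.upper_center]; linarith : w x₀ < -1 + ε)).and
      (D.isOpen.mem_nhds D.mem))
  refine ⟨min δ₁ δ₂, lt_min hδ₁ hδ₂, fun z hz u hu => ?_⟩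
  have hdist : ∀ y : EucSp n, dist (y + z) y = ‖z‖ := fun y => by simp [dist_eq_norm]
  have hcont : Continuous fun y => u (y + z) := hu.1.comp (continuous_add_const z)
  refine ⟨hu.1.max (hcont.sub continuous_const), fun x hx => ?_,
    fun y => (hu.2.2.1 y).trans (le_max_left _ _), fun y hy => max_le (hu.2.2.2.1 y hy) ?_,
    max_le hu.2.2.2.2 ?_⟩
  · refine SubAt.max (v := fun y => u (y + z) - ε) (fun _ => hu.2.1 x hx) fun hle => ?_
    have hxz : x + z ∈ Ω \ {x₀} := by
      refine ⟨?_, ?_⟩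
      · by_contra hxz
        have h3 := h₁ ((hdist x).trans_lt (hz.trans_le (min_le_left _ _)))
        rw [Real.dist_eq, D.lower_eq _ hxz] at h3
        rw [D.eq_zero hu hxz] at hle
        linarith [(abs_lt.1 h3).2, hu.2.2.1 x]
      · intro hxz
        have hxz : x + z = x₀ := hxz
        rw [hxz] at hle
        linarith [hu.2.2.2.2, hu.2.2.1 x, D.lower_bound x]
    have h4 : SubAt F.carrier (fun y => u ((1 : ℝ) • y + z)) x :=
      SubAt.comp_affine one_ne_zero (by simp) (by simpa using hu.2.1 _ hxz)
    simpa [sub_eq_add_neg] using h4.add_const (-ε)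
  · linarith [D.nonpos hu (y + z)]
  · obtain ⟨h3, h4⟩ := h₂ ((hdist x₀).trans_lt (hz.trans_le (min_le_right _ _)))
    linarith [D.le_upper hu (x₀ + z) (subset_closure h4)]

lemma continuous_envelope (D : PerronData F Ω x₀ u₀ w) :
    Continuous (perronEnvelope F Ω x₀ u₀) := by
  rw [Metric.continuous_iff]
  intro y ε hε
  obtain ⟨δ, hδ, h⟩ := D.max_translate_mem (half_pos hε)
  have key : ∀ a b : EucSp n, dist a b < δ →
      perronEnvelope F Ω x₀ u₀ a ≤ perronEnvelope F Ω x₀ u₀ b + ε / 2 := by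
    intro a b hab
    refine D.envelope_le fun u hu => ?_
    have h1 := D.le_envelope (h (a - b) (by rwa [← dist_eq_norm]) u hu) b
    have h2 := (le_max_right _ _).trans h1
    rw [add_sub_cancel] at h2
    linarith
  refine ⟨δ, hδ, fun a ha => ?_⟩
  rw [Real.dist_eq, abs_lt]
  have h1 := key a y ha
  have h2 := key y a (by rwa [dist_comm])
  constructor <;> linarith

lemma envelope_mem (D : PerronData F Ω x₀ u₀ w) :
    perronEnvelope F Ω x₀ u₀ ∈ perronFamily F Ω x₀ u₀ := by
  have : Nonempty (perronFamily F Ω x₀ u₀) := ⟨⟨u₀, D.lower_mem⟩⟩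
  refine ⟨D.continuous_envelope, fun x hx => ?_, D.le_envelope D.lower_mem,
    fun y hy => D.envelope_le fun u hu => hu.2.2.2.1 y hy,
    D.envelope_le fun u hu => hu.2.2.2.2⟩
  refine subAt_of_approx F.isClosed' ((D.isOpen.sdiff isClosed_singleton).mem_nhds hx)
    fun ε hε => ?_
  obtain ⟨u, hu⟩ := exists_lt_of_lt_ciSup (sub_lt_self (perronEnvelope F Ω x₀ u₀ x) hε)
  exact ⟨u.1, u.2.1, u.2.2.1, D.le_envelope u.2, hu⟩

lemma envelope_super (D : PerronData F Ω x₀ u₀ w) {x : EucSp n} (hx : x ∈ Ω \ {x₀}) :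
    SubAt (dualSet F.carrier) (fun y => -perronEnvelope F Ω x₀ u₀ y) x := by
  set G := perronEnvelope F Ω x₀ u₀ with hG
  have hGm : G ∈ perronFamily F Ω x₀ u₀ := D.envelope_mem
  intro ψ h1 h2 h3 hInt
  obtain ⟨η, hηF, hη⟩ : ∃ η : ℝ, -hessS ψ x + -(2 * η) • 1 ∈ interior F.carrier ∧ 0 < η := by
    have hlim : Tendsto (fun η : ℝ => -hessS ψ x + -(2 * η) • (1 : SymMat n)) (𝓝[>] 0)
        (𝓝 (-hessS ψ x)) := by
      have : ContinuousAt (fun η : ℝ => -hessS ψ x + -(2 * η) • (1 : SymMat n)) 0 := by fun_prop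
      have h := this.tendsto
      rw [mul_zero, neg_zero, zero_smul, add_zero] at h
      exact h.mono_left nhdsWithin_le_nhds
    exact ((hlim.eventually_mem (isOpen_interior.mem_nhds hInt)).and
      eventually_mem_nhdsWithin).exists
  have hlim : Tendsto (fun y => -hessS ψ y + -(2 * η) • (1 : SymMat n)) (𝓝 x)
      (𝓝 (-hessS ψ x + -(2 * η) • 1)) := ((hessS_continuousAt h1).neg.add_const _).tendsto
  obtain ⟨r', hr', hball⟩ := Metric.eventually_nhds_iff_ball.1
    (((hlim.eventually_mem (isOpen_interior.mem_nhds hηF)).and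
      (h1.eventually (by simp))).and (h2.and
        ((D.isOpen.sdiff isClosed_singleton).eventually_mem hx)))
  set r := r' / 2
  have hr : 0 < r := half_pos hr'
  have hrr' : r < r' := half_lt_self hr'
  set κ := η * r ^ 2 / 2
  have hκ : 0 < κ := by positivity
  set f : EucSp n → ℝ := fun y => -ψ y + -η * ‖y - x‖ ^ 2 + κ with hf
  have hfC : ∀ y ∈ Metric.ball x r', ContDiffAt ℝ 2 f y := fun y hy =>
    ((hball y hy).1.2.neg.add (contDiffAt_const.mul
      ((contDiff_id.sub contDiff_const).norm_sq ℝ).contDiffAt)).add contDiffAt_const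
  have hfF : ∀ y ∈ Metric.ball x r', SubAt F.carrier f y := by
    intro y hy
    have hsq : ContDiffAt ℝ 2 (fun y => ‖y - x‖ ^ 2) y :=
      ((contDiff_id.sub contDiff_const).norm_sq ℝ).contDiffAt
    have hψ := (hball y hy).1.2
    refine SubAt.add_const (subAt_of_hessS_mem F.isPosSet
      (hψ.neg.add (contDiffAt_const.mul hsq)) ?_) κ
    have h4 := interior_subset (hball y hy).1.1
    rw [hessS_add hψ.neg (contDiffAt_const.mul hsq), hessS_neg hψ, hessS_smul _ hsq, hessS_normSq,
      smul_smul]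
    convert h4 using 3
    ring
  set p : EucSp n → ℝ := (Metric.ball x r).indicator fun y => max 0 (f y - G y)
  have hp0 : ∀ y, 0 ≤ p y := fun y => Set.indicator_nonneg (fun _ _ => le_max_left _ _) y
  have hpc : Continuous p := by
    refine continuous_indicator (fun y hy => ?_) ?_
    · have hy' := Metric.frontier_ball_subset_sphere hy
      have hd : ‖y - x‖ = r := mem_sphere_iff_norm.1 hy'
      have h4 := (hball y (Metric.mem_ball.2 ((Metric.mem_sphere.1 hy').trans_lt hrr'))).2.1
      refine max_eq_left ?_
      simp only [hf, hd, κ]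
      nlinarith [mul_pos hη (pow_pos hr 2)]
    · refine ContinuousOn.mono ?_ Metric.closure_ball_subset_closedBall
      refine continuousOn_const.sup (ContinuousOn.sub (fun y hy => ?_) hGm.1.continuousOn)
      exact (hfC y (Metric.closedBall_subset_ball hrr' hy)).continuousAt.continuousWithinAt
  have hpX : ∀ y, y ∉ Metric.ball x r → G y + p y = G y := fun y hy => by
    rw [show p y = 0 from Set.indicator_of_notMem hy _, add_zero]
  have hpb : ∀ y ∈ Metric.ball x r, max (G y) (f y) = G y + p y := fun y hy => by
    rw [show p y = max 0 (f y - G y) from Set.indicator_of_mem hy _, ← max_add_add_left, add_zero,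
      add_sub_cancel]
  have hbX : Metric.ball x r ⊆ Ω \ {x₀} := fun y hy =>
    (hball y (Metric.ball_subset_ball hrr'.le hy)).2.2
  have hmem : (fun y => G y + p y) ∈ perronFamily F Ω x₀ u₀ := by
    refine ⟨hGm.1.add hpc, fun y hy => ?_, fun y => ?_, fun y hy => ?_, ?_⟩
    · by_cases hyb : y ∈ Metric.ball x r
      · refine (SubAt.max (fun _ => hGm.2.1 y hy) fun _ =>
          hfF y (Metric.ball_subset_ball hrr'.le hyb)).congr ?_
        filter_upwards [Metric.isOpen_ball.mem_nhds hyb] with a ha using hpb a ha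
      · exact (hGm.2.1 y hy).mono_fun (Eventually.of_forall fun a => by linarith [hp0 a])
          (hpX y hyb).symm
    · linarith [hp0 y, hGm.2.2.1 y]
    · refine (hpX y fun h => hy (hbX h).1).trans_le (hGm.2.2.2.1 y hy)
    · refine (hpX x₀ fun h => (hbX h).2 rfl).trans_le hGm.2.2.2.2
  have h4 := D.le_envelope hmem x
  rw [← hG] at h4
  have h5 := (le_max_right (G x) (f x)).trans_eq (hpb x (Metric.mem_ball_self hr))
  simp only [hf, sub_self, norm_zero] at h5
  have h6 : -G x = ψ x := h3
  norm_num at h5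
  linarith

end PerronData

/-- Barriers for the Perron method built from a singular harmonic function. -/
lemma exists_perronData (F : ConeSubequation n) (hconv : Convex ℝ F.carrier)
    {Ω : Set (EucSp n)} (hΩ : IsOpen Ω) (hb : Bornology.IsBounded Ω)
    (hbdry : StrictlyConvexBoundary F Ω) {x₀ : EucSp n} (hx₀ : x₀ ∈ Ω) {h : EucSp n → ℝ}
    (hhc : ContinuousOn h (closure Ω))
    (hharm : ∀ x ∈ Ω \ {x₀}, SubAt F.carrier h x ∧ SubAt (dualSet F.carrier) (fun y => -h y) x)
    (h0 : h x₀ = 0) (hpos : ∀ y ∈ closure Ω, y ≠ x₀ → 0 < h y) (hle : ∀ y ∈ frontier Ω, h y ≤ 1) :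
    ∃ u₀ w : EucSp n → ℝ, PerronData F Ω x₀ u₀ w ∧ ∀ y ∈ Ω, h y - 1 ≤ u₀ y := by
  obtain ⟨g, hgc, hg0, -, hgx, hgF⟩ := exists_barrier F hb hbdry hx₀
  have hfrc : IsCompact (frontier Ω) :=
    hb.isCompact_closure.of_isClosed_subset isClosed_frontier frontier_subset_closure
  have hfrpos : ∀ y ∈ frontier Ω, 0 < h y := fun y hy =>
    hpos y (frontier_subset_closure hy) fun hyx => by
      rw [hΩ.frontier_eq] at hy
      exact hy.2 (hyx ▸ hx₀)
  obtain ⟨k, hk0, hk⟩ : ∃ k : ℝ, 0 < k ∧ ∀ y ∈ frontier Ω, 1 ≤ k * h y := by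
    rcases (frontier Ω).eq_empty_or_nonempty with he | hne
    · exact ⟨1, one_pos, by simp [he]⟩
    · obtain ⟨y₁, hy₁, hmin⟩ := hfrc.exists_isMinOn hne (hhc.mono frontier_subset_closure)
      refine ⟨(h y₁)⁻¹, inv_pos.2 (hfrpos y₁ hy₁), fun y hy => ?_⟩
      rw [inv_mul_eq_div, one_le_div (hfrpos y₁ hy₁)]
      exact hmin hy
  have hnonneg : ∀ y ∈ Ω, 0 ≤ h y := fun y hy => by
    by_cases hyx : y = x₀
    · rw [hyx, h0]
    · exact (hpos y (subset_closure hy) hyx).le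
  have hin : ∀ y ∈ Ω, Ω.indicator (fun y => max (h y - 1) (g y)) y = max (h y - 1) (g y) :=
    fun y hy => Set.indicator_of_mem hy _
  have hout : ∀ y, y ∉ Ω → Ω.indicator (fun y => max (h y - 1) (g y)) y = 0 :=
    fun y hy => Set.indicator_of_notMem hy _
  refine ⟨Ω.indicator fun y => max (h y - 1) (g y), fun y => k * h y + -1,
    { convex := hconv
      isOpen := hΩ
      isBounded := hb
      mem := hx₀
      lower_continuous := ?_
      lower_sub := fun y hy => ?_
      lower_eq := hout
      lower_center := ?_
      lower_bound := fun y => ?_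
      upper_continuous := (continuousOn_const.mul hhc).add continuousOn_const
      upper_super := fun y hy => ?_
      upper_nonneg := fun y hy => by linarith [hk y hy]
      upper_center := by rw [h0]; ring }, fun y hy => by rw [hin y hy]; exact le_max_left _ _⟩
  · refine continuous_indicator (fun y hy => ?_)
      ((hhc.sub continuousOn_const).sup hgc.continuousOn)
    rw [hg0 y hy]
    exact max_eq_right (by linarith [hle y hy])
  · refine (SubAt.max (u := fun y => h y - 1) (v := g) (fun _ => ?_) fun hmax => ?_).congr ?_
    · simpa [sub_eq_add_neg] using (hharm y hy).1.add_const (-1)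
    · rcases hgF y hy.1 with hg | hg
      · linarith [hpos y (subset_closure hy.1) hy.2]
      · exact hg
    · filter_upwards [hΩ.mem_nhds hy.1] with a ha using (hin a ha).symm
  · rw [hin x₀ hx₀, h0, zero_sub]
    exact max_eq_left hgx
  · by_cases hy : y ∈ Ω
    · rw [hin y hy]
      exact le_max_of_le_left (by linarith [hnonneg y hy])
    · rw [hout y hy]
      norm_num
  · have := ((hharm y hy).2.const_mul F.dualSet_smul_mem hk0).add_const 1
    refine this.congr (Eventually.of_forall fun a => ?_)
    ring

/-- Harmonic functions on a punctured domain with zero boundary values are determined by their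
value at the puncture. -/
lemma eq_of_punctured_harmonic (F : ConeSubequation n) (hconv : Convex ℝ F.carrier)
    {Ω : Set (EucSp n)} (hΩ : IsOpen Ω) (hb : Bornology.IsBounded Ω) {x₀ : EucSp n}
    {u v : EucSp n → ℝ} (huc : Continuous u) (hvc : Continuous v) (hu0 : ∀ y, y ∉ Ω → u y = 0)
    (hv0 : ∀ y, y ∉ Ω → v y = 0)
    (hu : ∀ x ∈ Ω \ {x₀}, SubAt F.carrier u x ∧ SubAt (dualSet F.carrier) (fun y => -u y) x)
    (hv : ∀ x ∈ Ω \ {x₀}, SubAt F.carrier v x ∧ SubAt (dualSet F.carrier) (fun y => -v y) x)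
    (hx₀ : u x₀ = v x₀) : ∀ y ∈ closure Ω, u y = v y := by
  have hfr : ∀ y ∈ frontier Ω, y ∉ Ω := fun y hy => by
    rw [hΩ.frontier_eq] at hy
    exact hy.2
  intro y hy
  refine le_antisymm ?_ ?_
  · exact comparison_punctured F hconv hΩ hb huc hu0 (fun x hx => (hu x hx).1) hvc.continuousOn
      (fun x hx => (hv x hx).2) (fun y hy => (hv0 y (hfr y hy)).symm.le) hx₀.le y hy
  · exact comparison_punctured F hconv hΩ hb hvc hv0 (fun x hx => (hv x hx).1) huc.continuousOn
      (fun x hx => (hu x hx).2) (fun y hy => (hu0 y (hfr y hy)).symm.le) hx₀.symm.le y hy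

lemma ConeSubequation.punctured_nhds_neBot (F : ConeSubequation n) (x : EucSp n) :
    (𝓝[≠] x).NeBot := by
  have hn : n ≠ 0 := by
    rintro rfl
    obtain ⟨A, hA⟩ := F.nonempty'
    refine F.proper' (Set.eq_univ_iff_forall.2 fun B => ?_)
    rwa [show B = A from Subtype.ext (Matrix.ext fun i => i.elim0)]
  have : Nonempty (Fin n) := Fin.pos_iff_nonempty.1 (Nat.pos_of_ne_zero hn)
  exact Module.punctured_nhds_neBot ℝ (EucSp n) x

/-- Corollary 7.5, the nonlinear Green's function: under the hypotheses of
Theorem 7.4 there is a unique G ∈ C(Ω̄), F-harmonic on Ω∖{x₀}, vanishing on ∂Ω, with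
h-density 1 at x₀; moreover G(x₀) < 0 and x₀ is a strict global minimum of G on Ω̄. -/
theorem dirichlet_singularities_stmt14 {n : ℕ} (F : ConeSubequation n)
    (hconv : Convex ℝ F.carrier) (hF3 : CondF3 F)
    (Ω : Set (EucSp n)) (hΩ : IsBoundedDomain Ω) (hbdry : StrictlyConvexBoundary F Ω)
    (x₀ : EucSp n) (hx₀ : x₀ ∈ Ω)
    (h : EucSp n → ℝ) (hhc : ContinuousOn h (closure Ω))
    (hharm : FHarmonicOn F (Ω \ {x₀}) (fun y => (h y : EReal)))
    (hnotest : NoTestAt Ω (fun y => (h y : EReal)) x₀)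
    (h0 : h x₀ = 0) (hpos : ∀ y ∈ closure Ω, y ≠ x₀ → 0 < h y)
    (hsup : sSup (h '' frontier Ω) = 1)
    (hH3 : ∀ H : EucSp n → ℝ, ∀ U : Set (EucSp n), IsOpen U → x₀ ∈ U →
      FSubharmonicOn F.carrier U (fun y => (H y : EReal)) →
      FHarmonicOn F (U \ {x₀}) (fun y => (H y : EReal)) →
      ∃ Θ : ℝ, 0 ≤ Θ ∧
        Filter.Tendsto (fun y => (H y - H x₀) / h y) (𝓝[≠] x₀) (𝓝 Θ))
    (hH4 : ∀ H : EucSp n → ℝ, ∀ U : Set (EucSp n), IsOpen U → x₀ ∈ U →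
      FHarmonicOn F U (fun y => (H y : EReal)) →
      Filter.Tendsto (fun y => (H y - H x₀) / h y) (𝓝[≠] x₀) (𝓝 0)) :
    ∃ G : EucSp n → ℝ,
      (ContinuousOn G (closure Ω) ∧
       FHarmonicOn F (Ω \ {x₀}) (fun y => (G y : EReal)) ∧
       (∀ y ∈ frontier Ω, G y = 0) ∧
       Filter.Tendsto (fun y => (G y - G x₀) / h y) (𝓝[≠] x₀) (𝓝 1)) ∧
      (∀ G' : EucSp n → ℝ,
        (ContinuousOn G' (closure Ω) ∧
         FHarmonicOn F (Ω \ {x₀}) (fun y => (G' y : EReal)) ∧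
         (∀ y ∈ frontier Ω, G' y = 0) ∧
         Filter.Tendsto (fun y => (G' y - G' x₀) / h y) (𝓝[≠] x₀) (𝓝 1)) →
        Set.EqOn G G' (closure Ω)) ∧
      G x₀ < 0 ∧ (∀ y ∈ closure Ω, y ≠ x₀ → G x₀ < G y) := by
  obtain ⟨hΩo, -, hΩb⟩ := hΩ
  have hXo : IsOpen (Ω \ {x₀}) := hΩo.sdiff isClosed_singleton
  have hXK : Ω \ {x₀} ⊆ closure Ω := Set.sdiff_subset.trans subset_closure
  have hfrc : IsCompact (frontier Ω) :=
    hΩb.isCompact_closure.of_isClosed_subset isClosed_frontier frontier_subset_closure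
  have hfr : ∀ y ∈ frontier Ω, y ∉ Ω := fun y hy => by
    rw [hΩo.frontier_eq] at hy
    exact hy.2
  have hle : ∀ y ∈ frontier Ω, h y ≤ 1 := fun y hy => by
    rw [← hsup]
    exact le_csSup (hfrc.image_of_continuousOn (hhc.mono frontier_subset_closure)).bddAbove
      ⟨y, hy, rfl⟩
  obtain ⟨u₀, w, D, hu₀⟩ := exists_perronData F hconv hΩo hΩb hbdry hx₀ hhc
    ((fHarmonicOn_iff hXo (hhc.mono hXK)).1 hharm) h0 hpos hle
  set g := perronEnvelope F Ω x₀ u₀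
  have hgm : g ∈ perronFamily F Ω x₀ u₀ := D.envelope_mem
  have hgc : Continuous g := hgm.1
  have hg0 : ∀ y, y ∉ Ω → g y = 0 := fun y hy => D.eq_zero hgm hy
  have hgX : ∀ x ∈ Ω \ {x₀}, SubAt F.carrier g x ∧ SubAt (dualSet F.carrier) (fun y => -g y) x :=
    fun x hx => ⟨hgm.2.1 x hx, D.envelope_super hx⟩
  have hgx : g x₀ = -1 := le_antisymm hgm.2.2.2.2 (D.lower_center.symm.le.trans (hgm.2.2.1 x₀))
  have hgh : ∀ y ∈ Ω, h y - 1 ≤ g y := fun y hy => (hu₀ y hy).trans (hgm.2.2.1 y)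
  have hgsub : ∀ x ∈ Ω, SubAt F.carrier g x := by
    intro x hx
    by_cases hxx : x = x₀
    · subst hxx
      intro ψ h1 h2 h3
      refine absurd ⟨h1.add contDiffAt_const, ?_, ?_⟩ (hnotest fun y => ψ y + 1)
      · rw [hΩo.nhdsWithin_eq hx]
        filter_upwards [h2, hΩo.mem_nhds hx] with y hy hyΩ
        rw [EReal.coe_le_coe_iff]
        linarith [hgh y hyΩ]
      · rw [EReal.coe_eq_coe_iff]
        linarith
    · exact hgm.2.1 x ⟨hx, hxx⟩
  obtain ⟨Θ, -, hΘ⟩ := hH3 g Ω hΩo hx₀ ((fSubharmonicOn_iff hΩo hgc.continuousOn).2 hgsub)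
    ((fHarmonicOn_iff hXo hgc.continuousOn).2 hgX)
  have hne : (𝓝[≠] x₀).NeBot := F.punctured_nhds_neBot x₀
  have hnear : ∀ᶠ y in 𝓝[≠] x₀, y ∈ Ω ∧ 0 < h y := by
    filter_upwards [eventually_mem_nhdsWithin, mem_nhdsWithin_of_mem_nhds (hΩo.mem_nhds hx₀)]
      with y hy hyΩ using ⟨hyΩ, hpos y (subset_closure hyΩ) hy⟩
  have hΘ1 : 1 ≤ Θ := by
    refine ge_of_tendsto hΘ (hnear.mono fun y hy => ?_)
    rw [one_le_div hy.2, hgx]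
    linarith [hgh y hy.1]
  have hΘ0 : 0 < Θ := one_pos.trans_le hΘ1
  have hsmul : ∀ s : ℝ, 0 < s → ∀ x ∈ Ω \ {x₀}, SubAt F.carrier (fun y => s * g y) x ∧
      SubAt (dualSet F.carrier) (fun y => -(s * g y)) x := fun s hs x hx => by
    refine ⟨(hgX x hx).1.const_mul F.f2 hs, ?_⟩
    simpa only [mul_neg] using (hgX x hx).2.const_mul F.dualSet_smul_mem hs
  have hdens : ∀ s : ℝ, Tendsto (fun y => (s * g y - s * g x₀) / h y) (𝓝[≠] x₀) (𝓝 (s * Θ)) :=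
    fun s => (hΘ.const_mul s).congr fun y => by ring
  have hinv : 0 < Θ⁻¹ := inv_pos.2 hΘ0
  refine ⟨fun y => Θ⁻¹ * g y, ⟨(continuous_const.mul hgc).continuousOn, ?_, fun y hy => ?_, ?_⟩,
    ?_, ?_, fun y hy hyx => ?_⟩
  · exact (fHarmonicOn_iff hXo (continuous_const.mul hgc).continuousOn).2 (hsmul _ hinv)
  · simp only [hg0 y (hfr y hy), mul_zero]
  · simpa only [inv_mul_cancel₀ hΘ0.ne'] using hdens Θ⁻¹
  · rintro G' ⟨hG'c, hG'h, hG'0, hG'd⟩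
    set v := Ω.indicator G'
    have hvG : ∀ y ∈ Ω, v y = G' y := fun y hy => Set.indicator_of_mem hy _
    have hv0 : ∀ y, y ∉ Ω → v y = 0 := fun y hy => Set.indicator_of_notMem hy _
    have hvc : Continuous v := continuous_indicator hG'0 hG'c
    have hvX : ∀ x ∈ Ω \ {x₀}, SubAt F.carrier v x ∧
        SubAt (dualSet F.carrier) (fun y => -v y) x := by
      intro x hx
      obtain ⟨h1, h2⟩ := (fHarmonicOn_iff hXo (hG'c.mono hXK)).1 hG'h x hx
      have heq : G' =ᶠ[𝓝 x] v := by
        filter_upwards [hΩo.mem_nhds hx.1] with y hy using (hvG y hy).symm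
      exact ⟨h1.congr heq, h2.congr heq.neg⟩
    have hc' : G' x₀ < 0 := by
      by_contra! hcon
      have hcmp := comparison_punctured F hconv hΩo hΩb hvc hv0 (fun x hx => (hvX x hx).1)
        (w := fun _ => G' x₀) continuousOn_const (fun x _ => F.subAt_dualSet_const _ x)
        (fun _ _ => hcon) (hvG x₀ hx₀).le
      have : (1 : ℝ) ≤ 0 := by
        refine le_of_tendsto hG'd (hnear.mono fun y hy => ?_)
        refine div_nonpos_of_nonpos_of_nonneg (sub_nonpos.2 ?_) hy.2.le
        rw [← hvG y hy.1]
        exact hcmp y (subset_closure hy.1)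
      norm_num at this
    set s := -G' x₀ with hs
    have hs0 : 0 < s := neg_pos.2 hc'
    have heq : ∀ y ∈ closure Ω, s * g y = v y :=
      eq_of_punctured_harmonic F hconv hΩo hΩb (continuous_const.mul hgc) hvc
      (fun y hy => by rw [hg0 y hy, mul_zero]) hv0 (hsmul s hs0) hvX
      (by rw [hvG x₀ hx₀, hgx, hs]; ring)
    have hsΘ : s * Θ = 1 := by
      refine tendsto_nhds_unique ((hdens s).congr' (hnear.mono fun y hy => ?_)) hG'd
      simp only [heq y (subset_closure hy.1), heq x₀ (subset_closure hx₀), hvG y hy.1, hvG x₀ hx₀]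
    intro y hy
    have hy' := heq y hy
    rw [eq_inv_of_mul_eq_one_left hsΘ] at hy'
    by_cases hyΩ : y ∈ Ω
    · rw [← hvG y hyΩ]
      exact hy'
    · rw [hG'0 y (by rw [hΩo.frontier_eq]; exact ⟨hy, hyΩ⟩), ← hv0 y hyΩ]
      exact hy'
  · simp only [hgx]
    linarith
  · refine mul_lt_mul_of_pos_left ?_ hinv
    rw [hgx]
    by_cases hyΩ : y ∈ Ω
    · linarith [hgh y hyΩ, hpos y hy hyx]
    · rw [hg0 y hyΩ]
      norm_num
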